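/- Let p : ℝ^n → [1,∞) be measurable with p_+ < ∞. Then p(·) satisfies the A_∞ condition if and only if there exists t ∈ (0,1) such that the t-median maximal operator m_t is bounded on L^{p(·)} (i.e., there exists C > 0 with ‖m_t f‖_{p(·)} ≤ C‖f‖_{p(·)} for all f ∈ L^{p(·)}). -/

import Mathlib

open MeasureTheory ENNReal Set

noncomputable section

/-- An axis-parallel cube in `ℝⁿ`, given by its center and (positive) side length. -/
structure RCube (n : ℕ) where
  center : Fin n → ℝ
  side : ℝ
  side_pos : 0 < side

namespace RCube

/-- The (closed) cube as a subset of `ℝⁿ`. -/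
def toSet {n : ℕ} (Q : RCube n) : Set (Fin n → ℝ) :=
  {x | ∀ i, |x i - Q.center i| ≤ Q.side / 2}

/-- `rQ`: the cube concentric with `Q` whose side length is `r` times that of `Q`. -/
def scaledSet {n : ℕ} (Q : RCube n) (r : ℝ) : Set (Fin n → ℝ) :=
  {x | ∀ i, |x i - Q.center i| ≤ r * Q.side / 2}

end RCube

/-- A family of pairwise disjoint cubes. -/
def PairwiseDisjointCubes {n : ℕ} (F : Set (RCube n)) : Prop :=
  F.Pairwise fun Q₁ Q₂ => Disjoint Q₁.toSet Q₂.toSet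

/-- The variable Lebesgue norm `‖f‖_{p(·)}` for a real-valued (finite) exponent,
applied to an `ℝ≥0∞`-valued function: `inf {λ > 0 : ∫ (f/λ)^{p(x)} dx ≤ 1}`. -/
def vnorm {n : ℕ} (p : (Fin n → ℝ) → ℝ) (f : (Fin n → ℝ) → ℝ≥0∞) : ℝ≥0∞ :=
  sInf {lam : ℝ≥0∞ | 0 < lam ∧ (∫⁻ x, (f x / lam) ^ p x) ≤ 1}

/-- `t^e` for `t, e ∈ [0,∞]`, with the standard variable-exponent convention
`t^∞ = 0` for `t ≤ 1` and `t^∞ = ∞` for `t > 1`. -/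
def epow (t e : ℝ≥0∞) : ℝ≥0∞ :=
  if e = ∞ then (if t ≤ 1 then 0 else ∞) else t ^ e.toReal

/-- The variable Lebesgue norm for an exponent with values in `[1,∞]`. -/
def vnormE {n : ℕ} (p : (Fin n → ℝ) → ℝ≥0∞) (f : (Fin n → ℝ) → ℝ≥0∞) : ℝ≥0∞ :=
  sInf {lam : ℝ≥0∞ | 0 < lam ∧ (∫⁻ x, epow (f x / lam) (p x)) ≤ 1}

/-- `|f|` as an `ℝ≥0∞`-valued function. -/
def ofR {n : ℕ} (f : (Fin n → ℝ) → ℝ) : (Fin n → ℝ) → ℝ≥0∞ :=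
  fun x => ENNReal.ofReal |f x|

/-- The `ℝ≥0∞`-valued characteristic function of a set. -/
def chiE {n : ℕ} (S : Set (Fin n → ℝ)) : (Fin n → ℝ) → ℝ≥0∞ :=
  S.indicator fun _ => 1

/-- The Hardy--Littlewood maximal operator (over axis-parallel cubes containing `x`). -/
def hlMaximal {n : ℕ} (f : (Fin n → ℝ) → ℝ) (x : Fin n → ℝ) : ℝ≥0∞ :=
  ⨆ (Q : RCube n) (_ : x ∈ Q.toSet),
    (∫⁻ y in Q.toSet, ENNReal.ofReal |f y|) / volume Q.toSet

/-- `M` is bounded on `L^{p(·)}`: there is `C > 0` with `‖Mf‖_{p(·)} ≤ C ‖f‖_{p(·)}`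
for every `f ∈ L^{p(·)}`. -/
def MaximalBounded {n : ℕ} (p : (Fin n → ℝ) → ℝ) : Prop :=
  ∃ C > (0 : ℝ), ∀ f : (Fin n → ℝ) → ℝ, Measurable f → vnorm p (ofR f) < ∞ →
    vnorm p (hlMaximal f) ≤ ENNReal.ofReal C * vnorm p (ofR f)

/-- The function `∑_{Q ∈ F} t_Q χ_{E_Q}` (for a pairwise disjoint family,
written as a pointwise supremum). -/
def cubeSum {n : ℕ} (F : Set (RCube n)) (t : RCube n → ℝ)
    (E : RCube n → Set (Fin n → ℝ)) (x : Fin n → ℝ) : ℝ≥0∞ :=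
  ⨆ (Q : RCube n) (_ : Q ∈ F) (_ : x ∈ E Q), ENNReal.ofReal (t Q)

/-- `p(·)` satisfies the `A_∞` condition with parameter `lam` and constant `C`. -/
def AInftyWith {n : ℕ} (p : (Fin n → ℝ) → ℝ) (lam C : ℝ) : Prop :=
  ∀ F : Set (RCube n), PairwiseDisjointCubes F →
    ∀ t : RCube n → ℝ, (∀ Q ∈ F, 0 ≤ t Q) →
      ∀ E : RCube n → Set (Fin n → ℝ),
        (∀ Q ∈ F, MeasurableSet (E Q) ∧ E Q ⊆ Q.toSet ∧
          ENNReal.ofReal lam * volume Q.toSet ≤ volume (E Q)) →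
        vnorm p (cubeSum F t RCube.toSet) ≤ ENNReal.ofReal C * vnorm p (cubeSum F t E)

/-- The `A_∞` condition for a real-valued exponent. -/
def AInfty {n : ℕ} (p : (Fin n → ℝ) → ℝ) : Prop :=
  ∃ lam ∈ Ioo (0 : ℝ) 1, ∃ C > (0 : ℝ), AInftyWith p lam C

/-- `p(·)` satisfies the `A_∞` condition with parameter `lam` and constant `C`
(exponent with values in `[1,∞]`). -/
def AInftyWithE {n : ℕ} (p : (Fin n → ℝ) → ℝ≥0∞) (lam C : ℝ) : Prop :=
  ∀ F : Set (RCube n), PairwiseDisjointCubes F →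
    ∀ t : RCube n → ℝ, (∀ Q ∈ F, 0 ≤ t Q) →
      ∀ E : RCube n → Set (Fin n → ℝ),
        (∀ Q ∈ F, MeasurableSet (E Q) ∧ E Q ⊆ Q.toSet ∧
          ENNReal.ofReal lam * volume Q.toSet ≤ volume (E Q)) →
        vnormE p (cubeSum F t RCube.toSet) ≤ ENNReal.ofReal C * vnormE p (cubeSum F t E)

/-- The `A_∞` condition for an exponent with values in `[1,∞]`. -/
def AInftyE {n : ℕ} (p : (Fin n → ℝ) → ℝ≥0∞) : Prop :=
  ∃ lam ∈ Ioo (0 : ℝ) 1, ∃ C > (0 : ℝ), AInftyWithE p lam C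

/-- The nonincreasing-rearrangement value `(f χ_Q)^*(s) = inf {α : |{x ∈ Q : |f x| > α}| ≤ s}`. -/
def rearr {n : ℕ} (f : (Fin n → ℝ) → ℝ) (Q : RCube n) (s : ℝ≥0∞) : ℝ≥0∞ :=
  sInf {a : ℝ≥0∞ | volume {x | x ∈ Q.toSet ∧ a < ENNReal.ofReal |f x|} ≤ s}

/-- The `λ`-median maximal operator `m_λ`. -/
def medianMax {n : ℕ} (lam : ℝ) (f : (Fin n → ℝ) → ℝ) (x : Fin n → ℝ) : ℝ≥0∞ :=
  ⨆ (Q : RCube n) (_ : x ∈ Q.toSet), rearr f Q (ENNReal.ofReal lam * volume Q.toSet)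

/-- The modified median maximal operator `m_{τ,r}` (supremum over cubes `Q` with `x ∈ rQ`). -/
def medianMaxR {n : ℕ} (tau r : ℝ) (f : (Fin n → ℝ) → ℝ) (x : Fin n → ℝ) : ℝ≥0∞ :=
  ⨆ (Q : RCube n) (_ : x ∈ Q.scaledSet r), rearr f Q (ENNReal.ofReal tau * volume Q.toSet)

/-- The average `⟨f⟩_Q = (1/|Q|) ∫_Q f`. -/
def cubeAvg {n : ℕ} (f : (Fin n → ℝ) → ℝ) (Q : RCube n) : ℝ :=
  (∫ y in Q.toSet, f y) / (volume Q.toSet).toReal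

/-- `|T_F f|` for a pairwise disjoint family `F`, written as a pointwise supremum. -/
def avgSum {n : ℕ} (F : Set (RCube n)) (f : (Fin n → ℝ) → ℝ) (x : Fin n → ℝ) : ℝ≥0∞ :=
  ⨆ (Q : RCube n) (_ : Q ∈ F) (_ : x ∈ Q.toSet), ENNReal.ofReal |cubeAvg f Q|

/-- The reverse Hölder condition `RH`. -/
def RHCond {n : ℕ} (p : (Fin n → ℝ) → ℝ) : Prop :=
  ∃ r : ℝ, 1 < r ∧ ∃ C : ℝ, 0 < C ∧
    ∀ S : Set (RCube n), PairwiseDisjointCubes S →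
      ∀ t : RCube n → ℝ, (∀ Q ∈ S, 0 ≤ t Q) →
        (∑' Q : S, ∫⁻ x in Q.1.toSet, ENNReal.ofReal (t Q.1) ^ p x) ≤ 1 →
        (∑' Q : S, volume Q.1.toSet *
            ((∫⁻ x in Q.1.toSet, ENNReal.ofReal (t Q.1) ^ (r * p x)) / volume Q.1.toSet)
              ^ (1 / r)) ≤ ENNReal.ofReal C

/-! ### Cubes -/

lemma RCube.toSet_eq {n : ℕ} (Q : RCube n) :
    Q.toSet = Metric.closedBall Q.center (Q.side / 2) := by
  ext x
  have := Q.side_pos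
  simp [RCube.toSet, Metric.mem_closedBall, dist_pi_le_iff (by positivity : 0 ≤ Q.side / 2),
    Real.dist_eq]

lemma RCube.scaledSet_eq {n : ℕ} (Q : RCube n) (r : ℝ) (hr : 0 < r) :
    Q.scaledSet r = Metric.closedBall Q.center (r * (Q.side / 2)) := by
  ext x
  have := Q.side_pos
  simp [RCube.scaledSet, Metric.mem_closedBall,
    dist_pi_le_iff (by positivity : 0 ≤ r * (Q.side / 2)), Real.dist_eq, mul_div_assoc]

lemma RCube.vol {n : ℕ} (Q : RCube n) : volume Q.toSet = ENNReal.ofReal (Q.side ^ n) := by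
  have := Q.side_pos
  rw [Q.toSet_eq, Real.volume_pi_closedBall _ (by positivity)]
  simp; congr 1; ring

lemma RCube.vol_scaled {n : ℕ} (Q : RCube n) (r : ℝ) (hr : 0 < r) :
    volume (Q.scaledSet r) = ENNReal.ofReal (r ^ n) * volume Q.toSet := by
  have := Q.side_pos
  rw [Q.scaledSet_eq r hr, Q.vol, Real.volume_pi_closedBall _ (by positivity),
    ← ENNReal.ofReal_mul (by positivity)]
  simp; rw [← mul_pow]; congr 1; ring

lemma RCube.meas {n : ℕ} (Q : RCube n) : MeasurableSet Q.toSet := by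
  rw [Q.toSet_eq]; exact Metric.isClosed_closedBall.measurableSet

lemma RCube.vol_pos {n : ℕ} (Q : RCube n) : 0 < volume Q.toSet := by
  have := Q.side_pos
  rw [Q.vol]; simp; positivity

lemma RCube.vol_ne_zero {n : ℕ} (Q : RCube n) : volume Q.toSet ≠ 0 := Q.vol_pos.ne'

lemma RCube.vol_ne_top {n : ℕ} (Q : RCube n) : volume Q.toSet ≠ ∞ := by
  rw [Q.vol]; simp

lemma RCube.center_mem {n : ℕ} (Q : RCube n) : Q.center ∈ Q.toSet := by
  have := Q.side_pos
  rw [Q.toSet_eq]; exact Metric.mem_closedBall_self (by positivity)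

lemma PairwiseDisjointCubes.countable {n : ℕ} {F : Set (RCube n)} (hF : PairwiseDisjointCubes F) :
    F.Countable := by
  refine Set.PairwiseDisjoint.countable_of_nonempty_interior (s := RCube.toSet) (a := F) hF ?_
  intro Q _
  have := Q.side_pos
  refine ⟨Q.center, ?_⟩
  rw [Q.toSet_eq]
  exact Metric.ball_subset_interior_closedBall (Metric.mem_ball_self (by positivity))

lemma PairwiseDisjointCubes.subset {n : ℕ} {F F' : Set (RCube n)} (hF : PairwiseDisjointCubes F)
    (h : F' ⊆ F) : PairwiseDisjointCubes F' := Set.Pairwise.mono h hF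

/-- The union of a family of cubes. -/
def cubeU {n : ℕ} (F : Set (RCube n)) : Set (Fin n → ℝ) := ⋃ Q ∈ F, Q.toSet

lemma cubeU_meas {n : ℕ} {F : Set (RCube n)} (hF : F.Countable) : MeasurableSet (cubeU F) :=
  MeasurableSet.biUnion hF fun Q _ => Q.meas

/-- measure of the union as a sum -/
lemma cubeU_measure {n : ℕ} {F : Set (RCube n)} (hF : PairwiseDisjointCubes F)
    (μ : Measure (Fin n → ℝ)) (E : Set (Fin n → ℝ)) (hE : MeasurableSet E) :
    μ (E ∩ cubeU F) = ∑' Q : F, μ (E ∩ Q.1.toSet) := by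
  unfold cubeU
  rw [Set.inter_iUnion₂, measure_biUnion hF.countable]
  · intro a ha b hb hab
    exact (hF ha hb hab).mono inter_subset_right inter_subset_right
  · intro Q _; exact hE.inter Q.meas

lemma cubeU_measure' {n : ℕ} {F : Set (RCube n)} (hF : PairwiseDisjointCubes F)
    (μ : Measure (Fin n → ℝ)) :
    μ (cubeU F) = ∑' Q : F, μ Q.1.toSet := by
  have := cubeU_measure hF μ univ MeasurableSet.univ
  simpa using this

/-- The homothetic image of `B` with center `x` and ratio `s`. -/
def RCube.hom {n : ℕ} (B : RCube n) (x : Fin n → ℝ) (s : ℝ) (hs : 0 < s) : RCube n :=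
  ⟨fun i => (1 - s) * x i + s * B.center i, s * B.side, mul_pos hs B.side_pos⟩

lemma RCube.mem_hom {n : ℕ} (B : RCube n) (x : Fin n → ℝ) (hx : x ∈ B.toSet) (s : ℝ)
    (hs : 0 < s) : x ∈ (B.hom x s hs).toSet := by
  intro i
  have := hx i
  simp only [RCube.hom]
  have e : x i - ((1 - s) * x i + s * B.center i) = s * (x i - B.center i) := by ring
  rw [e, abs_mul, abs_of_pos hs]
  nlinarith

lemma RCube.hom_mono {n : ℕ} (B : RCube n) (x : Fin n → ℝ) (hx : x ∈ B.toSet) (s s' : ℝ)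
    (hs : 0 < s) (hs' : 0 < s') (h : s ≤ s') : (B.hom x s hs).toSet ⊆ (B.hom x s' hs').toSet := by
  intro y hy i
  have h1 := hx i
  have h2 := hy i
  simp only [RCube.hom] at *
  have e : y i - ((1 - s') * x i + s' * B.center i)
    = (y i - ((1 - s) * x i + s * B.center i)) + (s' - s) * (x i - B.center i) := by ring
  rw [e]
  refine (abs_add_le _ _).trans ?_
  rw [abs_mul, abs_of_nonneg (sub_nonneg.2 h)]
  nlinarith [mul_le_mul_of_nonneg_left h1 (sub_nonneg.2 h)]

lemma RCube.hom_one {n : ℕ} (B : RCube n) (x : Fin n → ℝ) :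
    (B.hom x 1 one_pos).toSet = B.toSet := by
  ext y; simp [RCube.hom, RCube.toSet]

lemma exists_hom {n : ℕ} (B : RCube n) (H : Set (Fin n → ℝ)) (hHm : MeasurableSet H) (β : ℝ)
    (hβ : 0 < β) (hβ1 : β < 1) (hH : volume (H ∩ B.toSet) ≤ ENNReal.ofReal β * volume B.toSet) :
    ∀ᵐ x ∂(volume : Measure (Fin n → ℝ)), x ∈ H → x ∈ B.toSet →
      ∃ (s : ℝ) (hs : 0 < s), s ≤ 1 ∧
        volume (H ∩ (B.hom x s hs).toSet) = ENNReal.ofReal β * volume (B.hom x s hs).toSet := by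
  have hd := IsUnifLocDoublingMeasure.ae_tendsto_measure_inter_div
    (volume : Measure (Fin n → ℝ)) H 1
  rw [ae_restrict_iff' hHm] at hd
  filter_upwards [hd] with x hx hxH hxB
  have hBs := B.side_pos
  have ht := hx hxH (l := nhdsWithin (0:ℝ) (Ioi 0))
    (fun s : ℝ => fun i => (1 - s) * x i + s * B.center i) (fun s => s * B.side / 2) (by
      refine tendsto_nhdsWithin_iff.2 ⟨?_, ?_⟩
      · have : Continuous fun s : ℝ => s * B.side / 2 := by fun_prop
        have h0 := this.tendsto 0
        simp only [zero_mul, zero_div] at h0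
        exact h0.mono_left nhdsWithin_le_nhds
      · filter_upwards [self_mem_nhdsWithin] with s hs
        have : 0 < s := hs
        simp only [mem_Ioi]; positivity) (by
      filter_upwards [self_mem_nhdsWithin] with s hs
      have h1 := B.mem_hom x hxB s hs
      rw [RCube.toSet_eq] at h1
      simpa [RCube.hom] using h1)
  have hev := (ht.eventually (lt_mem_nhds (a := ENNReal.ofReal β) (by simpa using hβ1))).and
    (Ioc_mem_nhdsGT (zero_lt_one (α := ℝ)))
  obtain ⟨s0, hs0, hs0p, hs01⟩ := hev.exists
  set V : ℝ → ℝ := fun s => if hs : 0 < s then volume.real (H ∩ (B.hom x s hs).toSet) else 0 with hV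
  have hfin : ∀ s hs, volume (H ∩ (B.hom x s hs).toSet) ≠ ∞ := fun s hs =>
    ne_top_of_le_ne_top (B.hom x s hs).vol_ne_top (measure_mono inter_subset_right)
  have hvr : ∀ s hs, volume.real (B.hom x s hs).toSet = (s * B.side) ^ n := by
    intro s hs
    rw [measureReal_def, RCube.vol, ENNReal.toReal_ofReal]; rfl
    have := (B.hom x s hs).side_pos
    positivity
  have hcmp : ∀ s s' : ℝ, 0 < s → s ≤ s' → V s ≤ V s' ∧
      V s' ≤ V s + ((s' * B.side) ^ n - (s * B.side) ^ n) := by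
    intro s s' hs hss
    have hs' := hs.trans_le hss
    simp only [hV, hs, hs', dif_pos]
    have hsub := B.hom_mono x hxB s s' hs hs' hss
    refine ⟨measureReal_mono (inter_subset_inter_right _ hsub) (hfin _ _), ?_⟩
    rw [← hvr s hs, ← hvr s' hs',
      ← measureReal_diff hsub (RCube.meas _) (RCube.vol_ne_top _)]
    refine le_trans (measureReal_mono (s₂ := (H ∩ (B.hom x s hs).toSet) ∪
      ((B.hom x s' hs').toSet \ (B.hom x s hs).toSet)) ?_ ?_) (measureReal_union_le _ _)
    · rintro y ⟨hy1, hy2⟩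
      by_cases hy : y ∈ (B.hom x s hs).toSet
      · exact Or.inl ⟨hy1, hy⟩
      · exact Or.inr ⟨hy2, hy⟩
    · exact measure_union_ne_top (hfin _ _)
        (ne_top_of_le_ne_top (RCube.vol_ne_top (B.hom x s' hs')) (measure_mono diff_subset))
  have hVc : ContinuousOn V (Ioi 0) := by
    intro s hs
    have hdist : ∀ a ∈ Ioi (0:ℝ), dist (V a) (V s) ≤ dist ((a * B.side) ^ n) ((s * B.side) ^ n) := by
      intro a ha
      rw [Real.dist_eq, Real.dist_eq]
      rcases le_total a s with h | h
      · obtain ⟨h1, h2⟩ := hcmp a s ha h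
        rw [abs_of_nonpos (by linarith), abs_of_nonpos (by linarith)]; linarith
      · obtain ⟨h1, h2⟩ := hcmp s a hs h
        rw [abs_of_nonneg (by linarith), abs_of_nonneg (by linarith)]; linarith
    refine tendsto_iff_dist_tendsto_zero.2 ?_
    refine squeeze_zero' (Filter.Eventually.of_forall fun _ => dist_nonneg)
      (eventually_nhdsWithin_of_forall hdist) ?_
    have hc : Continuous fun a : ℝ => (a * B.side) ^ n := by fun_prop
    exact (tendsto_iff_dist_tendsto_zero.1 (hc.tendsto s)).mono_left nhdsWithin_le_nhds
  have hgc : ContinuousOn (fun s => V s - β * (s * B.side) ^ n) (Icc s0 1) := by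
    refine (hVc.mono fun a ha => lt_of_lt_of_le hs0p ha.1).sub ?_
    fun_prop
  have hg0 : 0 ≤ V s0 - β * (s0 * B.side) ^ n := by
    simp only [hV, hs0p, dif_pos, ← hvr s0 hs0p]
    have h1 : ENNReal.ofReal β < volume (H ∩ (B.hom x s0 hs0p).toSet) /
        volume (B.hom x s0 hs0p).toSet := by
      have e : (B.hom x s0 hs0p).toSet = Metric.closedBall
        (fun i => (1 - s0) * x i + s0 * B.center i) (s0 * B.side / 2) := RCube.toSet_eq _
      rw [e]; exact hs0
    rw [ENNReal.lt_div_iff_mul_lt (Or.inl (RCube.vol_ne_zero _)) (Or.inl (RCube.vol_ne_top _))] at h1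
    have h2 := ENNReal.toReal_mono (hfin _ _) h1.le
    rw [ENNReal.toReal_mul, ENNReal.toReal_ofReal hβ.le] at h2
    simpa [measureReal_def] using h2
  have hg1 : V 1 - β * (1 * B.side) ^ n ≤ 0 := by
    simp only [hV, one_pos, dif_pos, ← hvr 1 one_pos]
    rw [B.hom_one]
    have h2 := ENNReal.toReal_mono
      (ENNReal.mul_ne_top ENNReal.ofReal_ne_top B.vol_ne_top) hH
    rw [ENNReal.toReal_mul, ENNReal.toReal_ofReal hβ.le] at h2
    simpa [measureReal_def] using h2
  obtain ⟨s, hs, hse⟩ := intermediate_value_Icc' hs01 hgc ⟨hg1, hg0⟩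
  have hsp : 0 < s := lt_of_lt_of_le hs0p hs.1
  refine ⟨s, hsp, hs.2, ?_⟩
  simp only [hV, hsp, dif_pos, ← hvr s hsp] at hse
  rw [← ENNReal.toReal_eq_toReal_iff' (hfin _ _)
    (ENNReal.mul_ne_top ENNReal.ofReal_ne_top (RCube.vol_ne_top _)), ENNReal.toReal_mul,
    ENNReal.toReal_ofReal hβ.le]
  simp only [measureReal_def] at hse
  linarith

lemma growth {n : ℕ} (B : RCube n) (H : Set (Fin n → ℝ)) (hHm : MeasurableSet H) (β : ℝ)
    (hβ : 0 < β) (hβ1 : β < 1) (hH : volume (H ∩ B.toSet) ≤ ENNReal.ofReal β * volume B.toSet) :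
    ∃ S : Set (RCube n), PairwiseDisjointCubes S ∧
      (∀ Q ∈ S, Q.toSet ⊆ B.toSet ∧ volume (H ∩ Q.toSet) = ENNReal.ofReal β * volume Q.toSet) ∧
      volume ((H ∩ B.toSet) \ ⋃ Q ∈ S, Q.scaledSet 5) = 0 := by
  have hae := exists_hom B H hHm β hβ hβ1 hH
  set T : Set (Fin n → ℝ) := {x | x ∈ B.toSet ∧ ∃ (s : ℝ) (hs : 0 < s), s ≤ 1 ∧
        volume (H ∩ (B.hom x s hs).toSet) = ENNReal.ofReal β * volume (B.hom x s hs).toSet} with hT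
  have hT' : ∀ x : Fin n → ℝ, ∃ Q : RCube n, x ∈ T → (x ∈ Q.toSet ∧ Q.toSet ⊆ B.toSet ∧
      Q.side ≤ B.side ∧ volume (H ∩ Q.toSet) = ENNReal.ofReal β * volume Q.toSet) := by
    intro x
    by_cases hx : x ∈ T
    · obtain ⟨hxB, s, hs, hs1, h⟩ := hx
      refine ⟨B.hom x s hs, fun _ => ⟨B.mem_hom x hxB s hs, ?_, ?_, h⟩⟩
      · have := B.hom_mono x hxB s 1 hs one_pos hs1
        rwa [B.hom_one] at this
      · simp only [RCube.hom]
        nlinarith [B.side_pos]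
    · exact ⟨B, fun h => absurd h hx⟩
  choose q hq using hT'
  obtain ⟨u, huT, hud, hcov⟩ := Vitali.exists_disjoint_subfamily_covering_enlargement_closedBall
    T (fun x => (q x).center) (fun x => (q x).side / 2) (B.side / 2)
    (fun a ha => by linarith [(hq a ha).2.2.1]) 5 (by norm_num)
  refine ⟨q '' u, ?_, ?_, ?_⟩
  · rintro _ ⟨a, ha, rfl⟩ _ ⟨b, hb, rfl⟩ hab
    have hab' : a ≠ b := fun h => hab (by rw [h])
    have := hud ha hb hab'
    simp only [RCube.toSet_eq]
    exact this
  · rintro _ ⟨a, ha, rfl⟩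
    exact ⟨(hq a (huT ha)).2.1, (hq a (huT ha)).2.2.2⟩
  · refine measure_mono_null ?_ (ae_iff.1 hae)
    rintro x ⟨⟨hxH, hxB⟩, hx⟩
    simp only [mem_setOf_eq]
    intro hcon
    apply hx
    have hxT : x ∈ T := ⟨hxB, hcon hxH hxB⟩
    obtain ⟨b, hb, hsub⟩ := hcov x hxT
    simp only [mem_iUnion]
    refine ⟨q b, mem_image_of_mem _ hb, ?_⟩
    rw [RCube.scaledSet_eq _ _ (by norm_num)]
    apply hsub
    rw [← RCube.toSet_eq]
    exact (hq x hxT).1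

lemma growthF {n : ℕ} (F : Set (RCube n)) (hF : PairwiseDisjointCubes F)
    (H : Set (Fin n → ℝ)) (hHm : MeasurableSet H) (β : ℝ)
    (hβ : 0 < β) (hβ1 : β < 1)
    (hH : ∀ B ∈ F, volume (H ∩ B.toSet) ≤ ENNReal.ofReal β * volume B.toSet) :
    ∃ S : Set (RCube n), PairwiseDisjointCubes S ∧
      (∀ Q ∈ S, volume (H ∩ Q.toSet) = ENNReal.ofReal β * volume Q.toSet) ∧
      cubeU S ⊆ cubeU F ∧
      volume ((H ∩ cubeU F) \ ⋃ Q ∈ S, Q.scaledSet 5) = 0 ∧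
      ∀ B ∈ F, volume (H ∩ B.toSet) ≤ ENNReal.ofReal (5 ^ n) * volume (cubeU S ∩ B.toSet) ∧
        volume (H ∩ (cubeU S ∩ B.toSet)) = ENNReal.ofReal β * volume (cubeU S ∩ B.toSet) := by
  have h : ∀ B : RCube n, ∃ S : Set (RCube n), B ∈ F → (PairwiseDisjointCubes S ∧
      (∀ Q ∈ S, Q.toSet ⊆ B.toSet ∧ volume (H ∩ Q.toSet) = ENNReal.ofReal β * volume Q.toSet) ∧
      volume ((H ∩ B.toSet) \ ⋃ Q ∈ S, Q.scaledSet 5) = 0) := by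
    intro B
    by_cases hB : B ∈ F
    · obtain ⟨S, hS⟩ := growth B H hHm β hβ hβ1 (hH B hB)
      exact ⟨S, fun _ => hS⟩
    · exact ⟨∅, fun h => absurd h hB⟩
  choose S hS using h
  have hUS : ∀ B ∈ F, cubeU (⋃ B ∈ F, S B) ∩ B.toSet = cubeU (S B) := by
    intro B hB
    ext x
    simp only [cubeU, mem_inter_iff, mem_iUnion, exists_prop]
    constructor
    · rintro ⟨⟨Q, ⟨B', hB', hQ⟩, hx⟩, hxB⟩
      have : B' = B := by
        by_contra hne
        exact (disjoint_left.1 (hF hB' hB hne)) (((hS B' hB').2.1 Q hQ).1 hx) hxB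
      subst this
      exact ⟨Q, hQ, hx⟩
    · rintro ⟨Q, hQ, hx⟩
      exact ⟨⟨Q, ⟨B, hB, hQ⟩, hx⟩, ((hS B hB).2.1 Q hQ).1 hx⟩
  refine ⟨⋃ B ∈ F, S B, ?_, ?_, ?_, ?_, ?_⟩
  · intro Q hQ Q' hQ' hne
    simp only [mem_iUnion, exists_prop] at hQ hQ'
    obtain ⟨B, hB, hQ⟩ := hQ
    obtain ⟨B', hB', hQ'⟩ := hQ'
    by_cases hBB : B = B'
    · subst hBB
      exact (hS B hB).1 hQ hQ' hne
    · exact (hF hB hB' hBB).mono ((hS B hB).2.1 Q hQ).1 ((hS B' hB').2.1 Q' hQ').1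
  · intro Q hQ
    simp only [mem_iUnion, exists_prop] at hQ
    obtain ⟨B, hB, hQ⟩ := hQ
    exact ((hS B hB).2.1 Q hQ).2
  · intro x hx
    simp only [cubeU, mem_iUnion, exists_prop] at hx ⊢
    obtain ⟨Q, ⟨B, hB, hQ⟩, hx⟩ := hx
    exact ⟨B, hB, ((hS B hB).2.1 Q hQ).1 hx⟩
  · refine measure_mono_null (t := ⋃ B ∈ F, ((H ∩ B.toSet) \ ⋃ Q ∈ S B, Q.scaledSet 5)) ?_ ?_
    · rintro x ⟨⟨hxH, hxU⟩, hx⟩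
      simp only [cubeU, mem_iUnion, exists_prop] at hxU hx ⊢
      obtain ⟨B, hB, hxB⟩ := hxU
      refine ⟨B, hB, ⟨hxH, hxB⟩, ?_⟩
      simp only [mem_iUnion, exists_prop]
      rintro ⟨Q, hQ, hxQ⟩
      exact hx ⟨Q, ⟨B, hB, hQ⟩, hxQ⟩
    · exact (measure_biUnion_null_iff hF.countable).2 fun B hB => (hS B hB).2.2
  · intro B hB
    rw [hUS B hB]
    obtain ⟨h1, h2, h3⟩ := hS B hB
    constructor
    · calc volume (H ∩ B.toSet) ≤ volume (((H ∩ B.toSet) \ ⋃ Q ∈ S B, Q.scaledSet 5) ∪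
            ⋃ Q ∈ S B, Q.scaledSet 5) := by
              apply measure_mono
              intro x hx
              by_cases hx2 : x ∈ ⋃ Q ∈ S B, Q.scaledSet 5
              · exact Or.inr hx2
              · exact Or.inl ⟨hx, hx2⟩
        _ ≤ volume ((H ∩ B.toSet) \ ⋃ Q ∈ S B, Q.scaledSet 5) +
            volume (⋃ Q ∈ S B, Q.scaledSet 5) := measure_union_le _ _
        _ = volume (⋃ Q ∈ S B, Q.scaledSet 5) := by rw [h3, zero_add]
        _ ≤ ∑' Q : S B, volume (Q.1.scaledSet 5) := measure_biUnion_le _ h1.countable _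
        _ = ∑' Q : S B, ENNReal.ofReal (5 ^ n) * volume Q.1.toSet := by
              congr 1; ext Q; exact Q.1.vol_scaled 5 (by norm_num)
        _ = ENNReal.ofReal (5 ^ n) * volume (cubeU (S B)) := by
              rw [ENNReal.tsum_mul_left, cubeU_measure' h1]
    · rw [cubeU_measure h1 _ H hHm, cubeU_measure' h1, ← ENNReal.tsum_mul_left]
      congr 1; ext Q; exact (h2 Q.1 Q.2).2

/-- Points covered by cubes of side at most `R` in which `G` has density at least `τ`. -/
def Om {n : ℕ} (τ : ℝ) (G : Set (Fin n → ℝ)) (R : ℝ) : Set (Fin n → ℝ) :=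
  {x | ∃ Q : RCube n, x ∈ Q.toSet ∧ Q.side ≤ R ∧
    ENNReal.ofReal τ * volume Q.toSet ≤ volume (G ∩ Q.toSet)}

/-- Points covered by cubes in which `G` has density at least `τ`. -/
def OmA {n : ℕ} (τ : ℝ) (G : Set (Fin n → ℝ)) : Set (Fin n → ℝ) :=
  {x | ∃ Q : RCube n, x ∈ Q.toSet ∧ ENNReal.ofReal τ * volume Q.toSet ≤ volume (G ∩ Q.toSet)}

lemma OmA_measure_le {n : ℕ} (τ : ℝ) (G : Set (Fin n → ℝ)) (μ : Measure (Fin n → ℝ)) (C : ℝ≥0∞)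
    (h : ∀ R : ℝ, μ (Om τ G R) ≤ C) : μ (OmA τ G) ≤ C := by
  have e : OmA τ G = ⋃ N : ℕ, Om τ G (N : ℝ) := by
    ext x
    simp only [OmA, Om, mem_iUnion]
    constructor
    · rintro ⟨Q, h1, h2⟩
      obtain ⟨N, hN⟩ := exists_nat_ge Q.side
      exact ⟨N, Q, h1, hN, h2⟩
    · rintro ⟨N, Q, h1, _, h2⟩
      exact ⟨Q, h1, h2⟩
  have hm : Monotone fun N : ℕ => Om τ G (N : ℝ) := by
    rintro a b hab x ⟨Q, h1, h2, h3⟩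
    exact ⟨Q, h1, h2.trans (by exact_mod_cast hab), h3⟩
  rw [e, hm.measure_iUnion]
  exact iSup_le fun N => h N

lemma besi (n : ℕ) : ∃ N : ℕ, ∀ (τ : ℝ) (_ : 0 < τ) (G : Set (Fin n → ℝ)) (R : ℝ),
    ∃ F : Fin N → Set (RCube n), (∀ i, PairwiseDisjointCubes (F i)) ∧
      (∀ i, ∀ Q ∈ F i, ENNReal.ofReal (τ / 2 ^ n) * volume Q.toSet ≤ volume (G ∩ Q.toSet)) ∧
      Om τ G R ⊆ ⋃ i, cubeU (F i) := by
  obtain ⟨N, t, ht, hN⟩ := HasBesicovitchCovering.no_satelliteConfig (α := Fin n → ℝ)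
  refine ⟨N, fun τ hτ G R => ?_⟩
  have hx : ∀ x : Om τ G R, ∃ Q : RCube n, x.1 ∈ Q.toSet ∧ Q.side ≤ R ∧
    ENNReal.ofReal τ * volume Q.toSet ≤ volume (G ∩ Q.toSet) := fun x => x.2
  choose q hq1 hq2 hq3 using hx
  let bp : Besicovitch.BallPackage (Om τ G R) (Fin n → ℝ) :=
    { c := fun x => x.1
      r := fun x => (q x).side
      rpos := fun x => (q x).side_pos
      r_bound := R
      r_le := hq2 }
  obtain ⟨s, hs1, hs2⟩ := Besicovitch.exist_disjoint_covering_families ht hN bp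
  let Q2 : Om τ G R → RCube n := fun x => ⟨x.1, 2 * (q x).side, by
    have := (q x).side_pos
    positivity⟩
  have hQ2 : ∀ x, (Q2 x).toSet = Metric.closedBall x.1 (q x).side := by
    intro x
    rw [RCube.toSet_eq]
    congr 1
    simp [Q2]
  refine ⟨fun i => Q2 '' s i, ?_, ?_, ?_⟩
  · rintro i _ ⟨a, ha, rfl⟩ _ ⟨b, hb, rfl⟩ hab
    have hab' : a ≠ b := fun h => hab (by rw [h])
    have := hs1 i ha hb hab'
    simp only [hQ2]
    exact this
  · rintro i _ ⟨a, ha, rfl⟩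
    have hsub : (q a).toSet ⊆ (Q2 a).toSet := by
      rw [hQ2, RCube.toSet_eq]
      intro y hy
      have h1 := hq1 a
      rw [RCube.toSet_eq] at h1
      rw [Metric.mem_closedBall] at *
      have := dist_triangle_right y a.1 (q a).center
      linarith
    calc ENNReal.ofReal (τ / 2 ^ n) * volume (Q2 a).toSet
        = ENNReal.ofReal τ * volume (q a).toSet := by
          have := (q a).side_pos
          rw [RCube.vol, RCube.vol, ← ENNReal.ofReal_mul (by positivity),
            ← ENNReal.ofReal_mul (by positivity)]
          congr 1
          simp only [Q2, mul_pow]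
          field_simp
      _ ≤ volume (G ∩ (q a).toSet) := hq3 a
      _ ≤ _ := measure_mono (inter_subset_inter_right _ hsub)
  · intro x hx
    have := hs2 ⟨⟨x, hx⟩, rfl⟩
    simp only [mem_iUnion, exists_prop, cubeU] at this ⊢
    obtain ⟨i, j, hj, hxj⟩ := this
    refine ⟨i, Q2 j, mem_image_of_mem _ hj, ?_⟩
    rw [hQ2]
    exact Metric.ball_subset_closedBall hxj

/-! ### The measures `u^p dx` -/

/-- the measure `u^{p(x)} dx` -/
def nu {n : ℕ} (p : (Fin n → ℝ) → ℝ) (u : ℝ) : Measure (Fin n → ℝ) :=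
  volume.withDensity fun x => ENNReal.ofReal (u ^ p x)

lemma nu_ac {n : ℕ} (p : (Fin n → ℝ) → ℝ) (u : ℝ) : nu p u ≪ volume :=
  withDensity_absolutelyContinuous _ _

lemma nu_dens_meas {n : ℕ} {p : (Fin n → ℝ) → ℝ} (hpm : Measurable p) (u : ℝ) :
    Measurable fun x => ENNReal.ofReal (u ^ p x) :=
  (Measurable.pow measurable_const hpm).ennreal_ofReal

lemma nu_mono {n : ℕ} {p : (Fin n → ℝ) → ℝ} (hp1 : ∀ x, 1 ≤ p x) {u v : ℝ} (hu : 0 < u)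
    (huv : u ≤ v) (A : Set (Fin n → ℝ)) : nu p u A ≤ nu p v A := by
  refine withDensity_mono (Filter.Eventually.of_forall fun x => ?_) A
  exact ENNReal.ofReal_le_ofReal (Real.rpow_le_rpow hu.le huv (by linarith [hp1 x]))

lemma nu_scale_le {n : ℕ} {p : (Fin n → ℝ) → ℝ} (hpm : Measurable p) {P : ℝ}
    (hP : ∀ x, p x ≤ P) {u c : ℝ} (hu : 0 < u)
    (hc : 1 ≤ c) (A : Set (Fin n → ℝ)) :
    nu p (c * u) A ≤ ENNReal.ofReal (c ^ P) * nu p u A := by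
  have : nu p (c * u) ≤ ENNReal.ofReal (c ^ P) • nu p u := by
    unfold nu
    rw [← withDensity_smul _ (nu_dens_meas hpm u)]
    refine withDensity_mono (Filter.Eventually.of_forall fun x => ?_)
    simp only [Pi.smul_apply, smul_eq_mul]
    rw [← ENNReal.ofReal_mul (by positivity), Real.mul_rpow (by linarith) hu.le]
    apply ENNReal.ofReal_le_ofReal
    gcongr
    exact hP x
  simpa using this A

lemma nu_scale_ge {n : ℕ} {p : (Fin n → ℝ) → ℝ} (hpm : Measurable p) (hp1 : ∀ x, 1 ≤ p x)
    {u c : ℝ} (hu : 0 < u) (hc : 1 ≤ c) (A : Set (Fin n → ℝ)) :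
    ENNReal.ofReal c * nu p u A ≤ nu p (c * u) A := by
  have : ENNReal.ofReal c • nu p u ≤ nu p (c * u) := by
    unfold nu
    rw [← withDensity_smul _ (nu_dens_meas hpm u)]
    refine withDensity_mono (Filter.Eventually.of_forall fun x => ?_)
    simp only [Pi.smul_apply, smul_eq_mul]
    rw [← ENNReal.ofReal_mul (by positivity), Real.mul_rpow (by linarith) hu.le]
    apply ENNReal.ofReal_le_ofReal
    gcongr
    exact Real.self_le_rpow_of_one_le hc (hp1 x)
  simpa using this A

/-- Modular form of the `A_∞` condition for constant coefficients. -/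
def PP {n : ℕ} (p : (Fin n → ℝ) → ℝ) (η C : ℝ) : Prop :=
  ∀ u : ℝ, 0 < u → ∀ F : Set (RCube n), PairwiseDisjointCubes F →
    ∀ E : Set (Fin n → ℝ), MeasurableSet E →
      (∀ Q ∈ F, ENNReal.ofReal η * volume Q.toSet ≤ volume (E ∩ Q.toSet)) →
      nu p u E ≤ 1 → nu p u (cubeU F) ≤ ENNReal.ofReal C

lemma PP_mono {n : ℕ} {p : (Fin n → ℝ) → ℝ} {η η' C : ℝ} (h : PP p η C) (hη : η ≤ η') :
    PP p η' C := by
  intro u hu F hF E hE hEQ h1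
  exact h u hu F hF E hE (fun Q hQ => le_trans (by gcongr) (hEQ Q hQ)) h1

/-- small form, abstract version -/
lemma small_of {n : ℕ} {p : (Fin n → ℝ) → ℝ} (hpm : Measurable p) (hp1 : ∀ x, 1 ≤ p x) {P : ℝ}
    (hP : ∀ x, p x ≤ P) (C : ℝ) (ε : ℝ) (hε : 0 < ε) :
    ∃ c : ℝ, 0 < c ∧ ∀ A B : Set (Fin n → ℝ),
      (∀ u : ℝ, 0 < u → nu p u A ≤ 1 → nu p u B ≤ ENNReal.ofReal C) →
      ∀ u : ℝ, 0 < u → nu p u A ≤ ENNReal.ofReal c → nu p u B ≤ ENNReal.ofReal ε := by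
  set s : ℝ := max 1 (C / ε) with hs
  have hs1 : 1 ≤ s := le_max_left _ _
  have hs0 : 0 < s := by linarith
  refine ⟨(s ^ P)⁻¹, by positivity, fun A B hAB u hu hA => ?_⟩
  have h1 : nu p (s * u) A ≤ 1 := by
    refine (nu_scale_le hpm hP hu hs1 A).trans ?_
    calc ENNReal.ofReal (s ^ P) * nu p u A ≤ ENNReal.ofReal (s ^ P) * ENNReal.ofReal (s ^ P)⁻¹ := by
          gcongr
      _ = 1 := by
          rw [← ENNReal.ofReal_mul (by positivity), mul_inv_cancel₀ (by positivity)]; simp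
  have h2 := (nu_scale_ge hpm hp1 hu hs1 B).trans (hAB (s * u) (by positivity) h1)
  have h3 : ENNReal.ofReal C ≤ ENNReal.ofReal s * ENNReal.ofReal ε := by
    rw [← ENNReal.ofReal_mul hs0.le]
    apply ENNReal.ofReal_le_ofReal
    have : C / ε ≤ s := le_max_right _ _
    rwa [div_le_iff₀ hε] at this
  have h4 := h2.trans h3
  rwa [ENNReal.mul_le_mul_iff_right (by simpa using hs0) ENNReal.ofReal_ne_top] at h4

/-- large form -/
lemma large_of {n : ℕ} {p : (Fin n → ℝ) → ℝ} (hpm : Measurable p) (hp1 : ∀ x, 1 ≤ p x) {P : ℝ}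
    (hP : ∀ x, p x ≤ P) (C D : ℝ) (hD : 1 ≤ D) (A B : Set (Fin n → ℝ))
    (hAB : ∀ u : ℝ, 0 < u → nu p u A ≤ 1 → nu p u B ≤ ENNReal.ofReal C) (u : ℝ) (hu : 0 < u)
    (hA : nu p u A ≤ ENNReal.ofReal D) : nu p u B ≤ ENNReal.ofReal (D ^ P * C) := by
  have hD0 : 0 < D := by linarith
  have e : D * (u / D) = u := by field_simp
  have h1 : nu p (u / D) A ≤ 1 := by
    have := nu_scale_ge hpm hp1 (u := u / D) (by positivity) hD A
    rw [e] at this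
    have h2 := this.trans hA
    have h3 : ENNReal.ofReal D * nu p (u / D) A ≤ ENNReal.ofReal D * 1 := by simpa using h2
    rwa [ENNReal.mul_le_mul_iff_right (by simpa using hD0) ENNReal.ofReal_ne_top] at h3
  have h2 := hAB (u / D) (by positivity) h1
  have h3 := nu_scale_le hpm hP (u := u / D) (by positivity) hD B
  rw [e] at h3
  rw [ENNReal.ofReal_mul (by positivity)]
  exact h3.trans (by gcongr)

lemma PP_step {n : ℕ} {p : (Fin n → ℝ) → ℝ} (hpm : Measurable p) (hp1 : ∀ x, 1 ≤ p x) {P : ℝ}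
    (hP : ∀ x, p x ≤ P) {lam C η C' : ℝ} (hl : 0 < lam) (hl1 : lam < 1) (h : PP p lam C)
    (hη : η ≤ lam) (hη0 : 0 < η) (h' : PP p η C') :
    ∃ C'', PP p (η / (1 + (1 - lam) / 5 ^ n)) C'' := by
  set c : ℝ := (1 - lam) / 5 ^ n with hc
  have hc0 : 0 < c := by
    have : 0 < 1 - lam := by linarith
    positivity
  set D : ℝ := 1 + max C 0 with hD
  have hD1 : 1 ≤ D := by simp [hD]
  refine ⟨D ^ P * C', fun u hu F hF E hE hEQ hE1 => ?_⟩
  set F' : Set (RCube n) := {B ∈ F | volume (E ∩ B.toSet) ≤ ENNReal.ofReal lam * volume B.toSet}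
    with hF'
  have hF'd : PairwiseDisjointCubes F' := hF.subset (sep_subset _ _)
  obtain ⟨S, hSd, hS1, hS2, hS3, hS4⟩ := growthF F' hF'd E hE lam hl hl1 (fun B hB => hB.2)
  have hSm := cubeU_meas hSd.countable
  refine large_of hpm hp1 hP C' D hD1 (E ∪ cubeU S) (cubeU F) ?_ u hu ?_
  · intro v hv hv1
    refine h' v hv F hF _ (hE.union hSm) (fun B hB => ?_) hv1
    by_cases hBF : B ∈ F'
    · obtain ⟨k1, k2⟩ := hS4 B hBF
      have hfin : volume (cubeU S ∩ B.toSet) ≠ ∞ :=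
        ne_top_of_le_ne_top B.vol_ne_top (measure_mono inter_subset_right)
      have hfin2 : volume (E ∩ B.toSet) ≠ ∞ :=
        ne_top_of_le_ne_top B.vol_ne_top (measure_mono inter_subset_right)
      have k3 : volume ((E ∪ cubeU S) ∩ B.toSet) + volume (E ∩ (cubeU S ∩ B.toSet))
          = volume (E ∩ B.toSet) + volume (cubeU S ∩ B.toSet) := by
        have := measure_union_add_inter (μ := volume) (E ∩ B.toSet) (hSm.inter B.meas)
        rw [← this]
        congr 2
        · ext x; simp; tauto
        · ext x; simp; tauto
      have hfin3 : volume ((E ∪ cubeU S) ∩ B.toSet) ≠ ∞ :=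
        ne_top_of_le_ne_top B.vol_ne_top (measure_mono inter_subset_right)
      have k0 := hEQ B hB
      rw [k2] at k3
      lift volume (cubeU S ∩ B.toSet) to NNReal using hfin with a ha
      lift volume (E ∩ B.toSet) to NNReal using hfin2 with b hb
      lift volume ((E ∪ cubeU S) ∩ B.toSet) to NNReal using hfin3 with d hd
      have hBf := B.vol_ne_top
      lift volume B.toSet to NNReal using hBf with v hv
      have j1 := ENNReal.toReal_mono (by finiteness) k1
      have j3 := congrArg ENNReal.toReal k3
      have j0 := ENNReal.toReal_mono (by finiteness) k0
      rw [ENNReal.toReal_mul, ENNReal.toReal_ofReal (by positivity)] at j1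
      rw [ENNReal.toReal_mul, ENNReal.toReal_ofReal (by positivity)] at j0
      rw [ENNReal.toReal_add (by finiteness) (by finiteness),
        ENNReal.toReal_add (by finiteness) (by finiteness), ENNReal.toReal_mul,
        ENNReal.toReal_ofReal (by positivity)] at j3
      rw [← ENNReal.toReal_le_toReal (by finiteness) (by finiteness), ENNReal.toReal_mul,
        ENNReal.toReal_ofReal (by positivity)]
      simp only [ENNReal.coe_toReal] at *
      have j4 : η * v ≤ (1 + c) * b := by
        rw [div_mul_eq_mul_div, div_le_iff₀ (by positivity)] at j0
        linarith
      have j5 : c * b ≤ (1 - lam) * a := by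
        rw [hc, div_mul_eq_mul_div, div_le_iff₀ (by positivity)]
        nlinarith
      linarith
    · have : ENNReal.ofReal lam * volume B.toSet ≤ volume (E ∩ B.toSet) := by
        by_contra hcon
        exact hBF ⟨hB, (not_le.1 hcon).le⟩
      calc ENNReal.ofReal η * volume B.toSet ≤ ENNReal.ofReal lam * volume B.toSet := by gcongr
        _ ≤ _ := this
        _ ≤ _ := measure_mono (inter_subset_inter_left _ subset_union_left)
  · refine (measure_union_le _ _).trans ?_
    have := h u hu S hSd E hE (fun Q hQ => (hS1 Q hQ).ge) hE1
    rw [hD, ENNReal.ofReal_add (by norm_num) (by positivity)]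
    gcongr
    · simpa using hE1
    · exact this.trans (ENNReal.ofReal_le_ofReal (le_max_left _ _))

lemma PP_all {n : ℕ} {p : (Fin n → ℝ) → ℝ} (hpm : Measurable p) (hp1 : ∀ x, 1 ≤ p x) {P : ℝ}
    (hP : ∀ x, p x ≤ P) {lam C : ℝ} (hl : 0 < lam) (hl1 : lam < 1) (h : PP p lam C) :
    ∀ η : ℝ, 0 < η → ∃ C', PP p η C' := by
  set c : ℝ := (1 - lam) / 5 ^ n with hc
  have hc0 : 0 < c := by
    have : 0 < 1 - lam := by linarith
    positivity
  have hk : ∀ k : ℕ, ∃ C', PP p (lam / (1 + c) ^ k) C' := by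
    intro k
    induction k with
    | zero => exact ⟨C, by simpa using h⟩
    | succ k ih =>
      obtain ⟨C', hC'⟩ := ih
      obtain ⟨C'', h''⟩ := PP_step hpm hp1 hP hl hl1 h
        (div_le_self hl.le (one_le_pow₀ (by linarith))) (by positivity) hC'
      refine ⟨C'', ?_⟩
      rwa [pow_succ, ← div_div]
  intro η hη
  obtain ⟨k, hk'⟩ := pow_unbounded_of_one_lt (lam / η) (by linarith : 1 < 1 + c)
  obtain ⟨C', hC'⟩ := hk k
  refine ⟨C', PP_mono hC' ?_⟩
  rw [div_le_iff₀ (by positivity)]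
  rw [div_lt_iff₀ hη] at hk'
  linarith

lemma weak {n : ℕ} {p : (Fin n → ℝ) → ℝ} (hall : ∀ η : ℝ, 0 < η → ∃ C', PP p η C') (τ : ℝ)
    (hτ : 0 < τ) : ∃ C : ℝ, ∀ u : ℝ, 0 < u → ∀ G : Set (Fin n → ℝ), MeasurableSet G →
      nu p u G ≤ 1 → nu p u (OmA τ G) ≤ ENNReal.ofReal C := by
  obtain ⟨N, hN⟩ := besi n
  obtain ⟨C, hC⟩ := hall (τ / 2 ^ n) (by positivity)
  refine ⟨N * max C 0, fun u hu G hG hG1 => OmA_measure_le _ _ _ _ fun R => ?_⟩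
  obtain ⟨F, hF1, hF2, hF3⟩ := hN τ hτ G R
  calc nu p u (Om τ G R) ≤ nu p u (⋃ i, cubeU (F i)) := measure_mono hF3
    _ ≤ ∑ i, nu p u (cubeU (F i)) := measure_iUnion_fintype_le _ _
    _ ≤ ∑ _i : Fin N, ENNReal.ofReal (max C 0) := by
        refine Finset.sum_le_sum fun i _ => (hC u hu (F i) (hF1 i) G hG (hF2 i) hG1).trans ?_
        exact ENNReal.ofReal_le_ofReal (le_max_left _ _)
    _ = ENNReal.ofReal (N * max C 0) := by
        rw [ENNReal.ofReal_mul (by positivity)]; simp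

lemma scaled5_sub {n : ℕ} (S : Set (RCube n)) :
    (⋃ Q ∈ S, Q.scaledSet 5) ⊆ OmA ((5 ^ n : ℝ)⁻¹) (cubeU S) := by
  intro x hx
  simp only [mem_iUnion] at hx
  obtain ⟨Q, hQ, hx⟩ := hx
  have hs := Q.side_pos
  have e : (⟨Q.center, 5 * Q.side, by positivity⟩ : RCube n).toSet = Q.scaledSet 5 := rfl
  refine ⟨⟨Q.center, 5 * Q.side, by positivity⟩, hx, ?_⟩
  rw [e, Q.vol_scaled 5 (by norm_num), ← mul_assoc, ← ENNReal.ofReal_mul (by positivity),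
    inv_mul_cancel₀ (by positivity)]
  simp only [ENNReal.ofReal_one, one_mul]
  refine measure_mono fun y hy => ⟨?_, fun i => ?_⟩
  · exact mem_biUnion hQ hy
  · have := hy i
    linarith

/-- One step of the reverse Hölder growth. -/
lemma rh_step {n : ℕ} {p : (Fin n → ℝ) → ℝ} (hpm : Measurable p) (hp1 : ∀ x, 1 ≤ p x) {P : ℝ}
    (hP : ∀ x, p x ≤ P) (hall : ∀ η : ℝ, 0 < η → ∃ C', PP p η C') :
    ∃ θ : ℝ, 1 < θ ∧ ∀ F : Set (RCube n), PairwiseDisjointCubes F →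
      ∀ H : Set (Fin n → ℝ), MeasurableSet H → H ⊆ cubeU F →
      (∀ B ∈ F, volume (H ∩ B.toSet) ≤ ENNReal.ofReal (1 / 2) * volume B.toSet) →
      ∃ H₁ : Set (Fin n → ℝ), MeasurableSet H₁ ∧ H₁ ⊆ cubeU F ∧
        (∀ B ∈ F, volume (H₁ ∩ B.toSet) ≤ 3 * volume (H ∩ B.toSet)) ∧
        ∀ u : ℝ, 0 < u → nu p u H₁ ≤ 1 → nu p (θ * u) H ≤ 1 := by
  have hP1 : 1 ≤ P := (hp1 0).trans (hP 0)
  obtain ⟨C, hC⟩ := hall (1 / 2) (by norm_num)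
  obtain ⟨C', hC'⟩ := weak hall ((5 ^ n : ℝ)⁻¹) (by positivity)
  set D : ℝ := max 1 C with hD
  obtain ⟨c, hc, hcs⟩ := small_of hpm hp1 hP (D ^ P * C') (1 / 2) (by norm_num)
  set q : ℝ := max (1 / 2) (1 - c) with hq
  have hq0 : 0 < q := lt_of_lt_of_le (by norm_num) (le_max_left _ _)
  have hq1 : q < 1 := max_lt (by norm_num) (by linarith)
  set θ : ℝ := q⁻¹ ^ (P⁻¹) with hθ
  have hP0 : 0 < P := by linarith
  have hθ1 : 1 < θ := Real.one_lt_rpow ((one_lt_inv₀ hq0).2 hq1) (by positivity)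
  have hθP : θ ^ P = q⁻¹ := by
    rw [hθ, ← Real.rpow_mul (by positivity), inv_mul_cancel₀ hP0.ne', Real.rpow_one]
  refine ⟨θ, hθ1, fun F hF H hH hHF hHB => ?_⟩
  obtain ⟨S, hSd, hS1, hS2, hS3, hS4⟩ := growthF F hF H hH (1 / 2) (by norm_num) (by norm_num) hHB
  have hSm := cubeU_meas hSd.countable
  refine ⟨H ∪ cubeU S, hH.union hSm, union_subset hHF hS2, fun B hB => ?_, fun u hu h1 => ?_⟩
  · obtain ⟨-, k⟩ := hS4 B hB
    have k2 : volume (cubeU S ∩ B.toSet) ≤ 2 * volume (H ∩ B.toSet) := by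
      calc volume (cubeU S ∩ B.toSet) = 2 * (ENNReal.ofReal (1/2) * volume (cubeU S ∩ B.toSet)) := by
            rw [← mul_assoc]
            have : (2 : ℝ≥0∞) = ENNReal.ofReal 2 := by simp
            rw [this, ← ENNReal.ofReal_mul (by norm_num)]; norm_num
        _ = 2 * volume (H ∩ (cubeU S ∩ B.toSet)) := by rw [k]
        _ ≤ _ := by
            gcongr
            exact inter_subset_right
    calc volume ((H ∪ cubeU S) ∩ B.toSet) ≤ volume (H ∩ B.toSet) + volume (cubeU S ∩ B.toSet) := by
          rw [union_inter_distrib_right]; exact measure_union_le _ _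
      _ ≤ volume (H ∩ B.toSet) + 2 * volume (H ∩ B.toSet) := by gcongr
      _ = 3 * volume (H ∩ B.toSet) := by ring
  · have key : ∀ v : ℝ, 0 < v → nu p v (cubeU S \ H) ≤ 1 →
        nu p v H ≤ ENNReal.ofReal (D ^ P * C') := by
      intro v hv hv1
      have a1 : nu p v (cubeU S) ≤ ENNReal.ofReal C := by
        refine hC v hv S hSd _ (hSm.diff hH) (fun Q hQ => ?_) hv1
        have b1 : Q.toSet \ H ⊆ (cubeU S \ H) ∩ Q.toSet := fun x hx =>
          ⟨⟨mem_biUnion hQ hx.1, hx.2⟩, hx.1⟩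
        refine le_trans ?_ (measure_mono b1)
        have b2 := measure_inter_add_sdiff (μ := volume) Q.toSet hH
        rw [inter_comm, hS1 Q hQ] at b2
        have b3 : ENNReal.ofReal (1/2) * volume Q.toSet + ENNReal.ofReal (1/2) * volume Q.toSet
            = volume Q.toSet := by
          rw [← add_mul, ← ENNReal.ofReal_add (by norm_num) (by norm_num)]; norm_num
        rw [← b3] at b2
        have hne : ENNReal.ofReal (1/2) * volume Q.toSet ≠ ∞ :=
          ENNReal.mul_ne_top (by simp) Q.vol_ne_top
        have b4 : ENNReal.ofReal (1/2) * (ENNReal.ofReal (1/2) * volume Q.toSet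
          + ENNReal.ofReal (1/2) * volume Q.toSet) = ENNReal.ofReal (1/2) * volume Q.toSet := by
          rw [b3]
        rw [b4] at b2
        exact ((ENNReal.add_right_inj hne).1 b2).ge
      have a2 : nu p v (OmA ((5 ^ n : ℝ)⁻¹) (cubeU S)) ≤ ENNReal.ofReal (D ^ P * C') :=
        large_of hpm hp1 hP C' D (le_max_left _ _) (cubeU S) _
          (fun w hw hw1 => hC' w hw _ hSm hw1) v hv
          (a1.trans (ENNReal.ofReal_le_ofReal (le_max_right _ _)))
      refine le_trans ?_ a2
      have a3 : nu p v ((H ∩ cubeU F) \ ⋃ Q ∈ S, Q.scaledSet 5) = 0 := nu_ac p v hS3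
      rw [inter_eq_self_of_subset_left hHF] at a3
      calc nu p v H ≤ nu p v (H \ ⋃ Q ∈ S, Q.scaledSet 5) + nu p v (⋃ Q ∈ S, Q.scaledSet 5) := by
            refine (measure_mono ?_).trans (measure_union_le _ _)
            intro x hx
            by_cases h : x ∈ ⋃ Q ∈ S, Q.scaledSet 5
            · exact Or.inr h
            · exact Or.inl ⟨hx, h⟩
        _ = nu p v (⋃ Q ∈ S, Q.scaledSet 5) := by rw [a3, zero_add]
        _ ≤ _ := measure_mono (scaled5_sub S)
    have hHq : nu p u H ≤ ENNReal.ofReal q := by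
      by_cases hA : nu p u (cubeU S \ H) ≤ ENNReal.ofReal c
      · exact (hcs _ _ key u hu hA).trans (ENNReal.ofReal_le_ofReal (le_max_left _ _))
      · have hA' := (not_le.1 hA).le
        have s1 : nu p u H + nu p u (cubeU S \ H) ≤ 1 := by
          rw [← measure_union disjoint_sdiff_right (hSm.diff hH)]
          refine le_trans (measure_mono ?_) h1
          rw [union_sdiff_self]
        have s2 : nu p u H + ENNReal.ofReal c ≤ 1 := le_trans (by gcongr) s1
        have s3 : nu p u H ≤ 1 - ENNReal.ofReal c := ENNReal.le_sub_of_add_le_right (by simp) s2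
        refine s3.trans ?_
        rw [← ENNReal.ofReal_one, ← ENNReal.ofReal_sub _ hc.le]
        exact ENNReal.ofReal_le_ofReal (le_max_right _ _)
    refine (nu_scale_le hpm hP hu hθ1.le H).trans ?_
    rw [hθP]
    calc ENNReal.ofReal q⁻¹ * nu p u H ≤ ENNReal.ofReal q⁻¹ * ENNReal.ofReal q := by gcongr
      _ = 1 := by
        rw [← ENNReal.ofReal_mul (by positivity), inv_mul_cancel₀ hq0.ne']; simp

lemma decay {n : ℕ} {p : (Fin n → ℝ) → ℝ} (hpm : Measurable p) (hp1 : ∀ x, 1 ≤ p x) {P : ℝ}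
    (hP : ∀ x, p x ≤ P) (hall : ∀ η : ℝ, 0 < η → ∃ C', PP p η C') :
    ∃ θ : ℝ, 1 < θ ∧ ∀ F : Set (RCube n), PairwiseDisjointCubes F →
      ∀ (u : ℝ), 0 < u → nu p u (cubeU F) ≤ 1 → ∀ (l : ℕ) (H : Set (Fin n → ℝ)),
      MeasurableSet H → H ⊆ cubeU F →
      (∀ B ∈ F, volume (H ∩ B.toSet) ≤ ENNReal.ofReal ((3 ^ l)⁻¹) * volume B.toSet) →
      nu p u H ≤ ENNReal.ofReal ((θ ^ l)⁻¹) := by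
  obtain ⟨θ, hθ, h⟩ := rh_step hpm hp1 hP hall
  refine ⟨θ, hθ, fun F hF u hu hF1 => ?_⟩
  have main : ∀ (l : ℕ) (H : Set (Fin n → ℝ)),
      MeasurableSet H → H ⊆ cubeU F →
      (∀ B ∈ F, volume (H ∩ B.toSet) ≤ ENNReal.ofReal ((3 ^ l)⁻¹) * volume B.toSet) →
      nu p (θ ^ l * u) H ≤ 1 := by
    intro l
    induction l with
    | zero => 
      intro H _ hHF _
      simpa using (measure_mono hHF).trans hF1
    | succ l ih =>
      intro H hH hHF hHB
      obtain ⟨H₁, k1, k2, k3, k4⟩ := h F hF H hH hHF (fun B hB => (hHB B hB).trans (by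
        gcongr
        rw [pow_succ, inv_eq_one_div]
        have : (1:ℝ) ≤ 3 ^ l := one_le_pow₀ (by norm_num)
        exact one_div_le_one_div_of_le (by norm_num) (by linarith)))
      have := k4 (θ ^ l * u) (by positivity) (ih H₁ k1 k2 (fun B hB => by
        refine (k3 B hB).trans ?_
        calc 3 * volume (H ∩ B.toSet) ≤ 3 * (ENNReal.ofReal ((3 ^ (l+1))⁻¹) * volume B.toSet) := by
              gcongr; exact hHB B hB
          _ = _ := by
            have : (3 : ℝ≥0∞) = ENNReal.ofReal 3 := by simp
            rw [← mul_assoc, this, ← ENNReal.ofReal_mul (by norm_num)]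
            congr 2
            rw [pow_succ]; field_simp))
      rwa [pow_succ', mul_assoc]
  intro l H hH hHF hHB
  have := (nu_scale_ge hpm hp1 hu (one_le_pow₀ hθ.le : 1 ≤ θ ^ l) H).trans (main l H hH hHF hHB)
  have hpos : 0 < θ ^ l := by positivity
  rw [ENNReal.ofReal_inv_of_pos hpos]
  rw [← one_div, ENNReal.le_div_iff_mul_le (by left; simpa using hpos) (by left; simp), mul_comm]
  exact this

/-- quantiles -/
lemma quantile {n : ℕ} {p : (Fin n → ℝ) → ℝ} (hpm : Measurable p) (hp1 : ∀ x, 1 ≤ p x) {P : ℝ}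
    (hP : ∀ x, p x ≤ P) (β : ℝ) (hβ : 0 < β) (hβ1 : β < 1) (B : RCube n) :
    ∃ m : ℝ, ENNReal.ofReal β * volume B.toSet ≤ volume (B.toSet ∩ {x | p x ≤ m}) ∧
      ENNReal.ofReal (1 - β) * volume B.toSet ≤ volume (B.toSet ∩ {x | m ≤ p x}) := by
  set M : Set ℝ := {m | ENNReal.ofReal β * volume B.toSet ≤ volume (B.toSet ∩ {x | p x ≤ m})}
    with hM
  have hfin : ∀ A : Set (Fin n → ℝ), volume (B.toSet ∩ A) ≠ ∞ := fun A =>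
    ne_top_of_le_ne_top B.vol_ne_top (measure_mono inter_subset_left)
  have hne : M.Nonempty := by
    refine ⟨P, ?_⟩
    have : B.toSet ∩ {x | p x ≤ P} = B.toSet := by ext x; simp [hP x]
    simp only [hM, mem_ofPred_eq, this]
    calc ENNReal.ofReal β * volume B.toSet ≤ 1 * volume B.toSet := by
          gcongr; simpa using hβ1.le
      _ = _ := one_mul _
  have hbd : BddBelow M := by
    refine ⟨1, fun m hm => ?_⟩
    by_contra hlt
    have : B.toSet ∩ {x | p x ≤ m} = ∅ := by
      ext x; simp; intro _; linarith [hp1 x, not_le.1 hlt]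
    simp only [hM, mem_ofPred_eq, this, measure_empty, nonpos_iff_eq_zero, mul_eq_zero] at hm
    rcases hm with hm | hm
    · simp at hm; linarith
    · exact B.vol_ne_zero hm
  set m := sInf M with hm
  refine ⟨m, ?_, ?_⟩
  · have e : B.toSet ∩ {x | p x ≤ m} = ⋂ k : ℕ, B.toSet ∩ {x | p x ≤ m + 1 / ((k : ℝ) + 1)} := by
      ext x
      simp only [mem_inter_iff, mem_ofPred_eq, mem_iInter]
      constructor
      · rintro ⟨h1, h2⟩ k
        have : 0 < 1 / ((k : ℝ) + 1) := by positivity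
        exact ⟨h1, by linarith⟩
      · intro h
        refine ⟨(h 0).1, le_of_forall_pos_le_add fun ε hε => ?_⟩
        obtain ⟨k, hk⟩ := exists_nat_one_div_lt hε
        linarith [(h k).2]
    have hanti : Antitone fun k : ℕ => B.toSet ∩ {x | p x ≤ m + 1 / ((k : ℝ) + 1)} := by
      intro i j hij x hx
      refine ⟨hx.1, le_trans (show p x ≤ _ from hx.2) ?_⟩
      have : 1 / ((j : ℝ) + 1) ≤ 1 / ((i : ℝ) + 1) := by gcongr
      linarith
    rw [e, hanti.measure_iInter (fun k => (B.meas.inter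
      (measurableSet_le hpm measurable_const)).nullMeasurableSet) ⟨0, hfin _⟩]
    refine le_iInf fun k => ?_
    have hk : 0 < 1 / ((k : ℝ) + 1) := by positivity
    obtain ⟨m', hm', hlt⟩ := exists_lt_of_csInf_lt hne (show sInf M < m + 1 / ((k : ℝ) + 1) by linarith)
    refine le_trans hm' (measure_mono ?_)
    rintro x ⟨h1, h2⟩
    exact ⟨h1, le_trans h2 hlt.le⟩
  · have e : B.toSet ∩ {x | p x < m} = ⋃ k : ℕ, B.toSet ∩ {x | p x ≤ m - 1 / ((k : ℝ) + 1)} := by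
      ext x
      simp only [mem_inter_iff, mem_ofPred_eq, mem_iUnion]
      constructor
      · rintro ⟨h1, h2⟩
        obtain ⟨k, hk⟩ := exists_nat_one_div_lt (sub_pos.2 h2)
        exact ⟨k, h1, by linarith⟩
      · rintro ⟨k, h1, h2⟩
        have : 0 < 1 / ((k : ℝ) + 1) := by positivity
        exact ⟨h1, by linarith⟩
    have hmono : Monotone fun k : ℕ => B.toSet ∩ {x | p x ≤ m - 1 / ((k : ℝ) + 1)} := by
      intro i j hij x hx
      refine ⟨hx.1, le_trans (show p x ≤ _ from hx.2) ?_⟩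
      have : 1 / ((j : ℝ) + 1) ≤ 1 / ((i : ℝ) + 1) := by gcongr
      linarith
    have h1 : volume (B.toSet ∩ {x | p x < m}) ≤ ENNReal.ofReal β * volume B.toSet := by
      rw [e, hmono.measure_iUnion]
      refine iSup_le fun k => ?_
      by_contra hcon
      have hk : 0 < 1 / ((k : ℝ) + 1) := by positivity
      have : m ≤ m - 1 / ((k : ℝ) + 1) := csInf_le hbd (not_le.1 hcon).le
      linarith
    have h2 := measure_inter_add_sdiff (μ := volume) B.toSet (measurableSet_lt hpm (measurable_const (a := m)))
    have e2 : B.toSet \ {x | p x < m} = B.toSet ∩ {x | m ≤ p x} := by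
      ext x; simp
    rw [e2] at h2
    have h3 : volume B.toSet ≤ ENNReal.ofReal β * volume B.toSet + volume (B.toSet ∩ {x | m ≤ p x}) := by
      rw [← h2]
      exact add_le_add (by rw [h2]; exact h1) le_rfl
    have h4 : ENNReal.ofReal β * volume B.toSet + ENNReal.ofReal (1 - β) * volume B.toSet
        = volume B.toSet := by
      rw [← add_mul, ← ENNReal.ofReal_add hβ.le (by linarith)]; simp
    have h5 : ENNReal.ofReal β * volume B.toSet ≠ ∞ := ENNReal.mul_ne_top (by simp) B.vol_ne_top
    refine (ENNReal.add_le_add_iff_left h5).1 ?_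
    rw [h4]; exact h3

lemma exists_scale {n : ℕ} {p : (Fin n → ℝ) → ℝ} (hpm : Measurable p) (hp1 : ∀ x, 1 ≤ p x) {P : ℝ}
    (hP : ∀ x, p x ≤ P) (X : Set (Fin n → ℝ)) (α w : ℝ) (hα : 0 < α) (h1 : nu p α X ≤ 1)
    (h2 : 1 < nu p w X) (hw : 0 < w) :
    ∃ u : ℝ, α ≤ u ∧ u ≤ w ∧ nu p u X ≤ 1 ∧ ENNReal.ofReal ((2 ^ P)⁻¹) < nu p u X := by
  have hex : ∃ k : ℕ, 1 < nu p (2 ^ (k + 1) * α) X := by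
    obtain ⟨k, hk⟩ := pow_unbounded_of_one_lt (w / α) (by norm_num : (1:ℝ) < 2)
    refine ⟨k, h2.trans_le (nu_mono hp1 hw ?_ X)⟩
    rw [div_lt_iff₀ hα] at hk
    rw [pow_succ]
    nlinarith [pow_pos (by norm_num : (0:ℝ) < 2) k]
  classical
  set k := Nat.find hex with hk
  have hk1 := Nat.find_spec hex
  rw [← hk] at hk1
  have hle : nu p (2 ^ k * α) X ≤ 1 := by
    rcases Nat.eq_zero_or_pos k with h0 | h0
    · rw [h0]; simpa using h1
    · have := Nat.find_min hex (show k - 1 < Nat.find hex by omega)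
      rw [show k - 1 + 1 = k by omega] at this
      exact not_lt.1 this
  refine ⟨2 ^ k * α, ?_, ?_, hle, ?_⟩
  · exact le_mul_of_one_le_left hα.le (one_le_pow₀ (by norm_num))
  · by_contra hcon
    exact absurd (nu_mono hp1 hw (not_le.1 hcon).le X) (not_le.2 (hle.trans_lt h2))
  · have := nu_scale_le hpm hP (u := 2 ^ k * α) (by positivity) (by norm_num : (1:ℝ) ≤ 2) X
    rw [← mul_assoc, ← pow_succ'] at this
    have h3 := hk1.trans_le this
    by_contra hcon
    refine absurd h3 (not_lt.2 ?_)
    calc ENNReal.ofReal (2 ^ P) * nu p (2 ^ k * α) X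
        ≤ ENNReal.ofReal (2 ^ P) * ENNReal.ofReal ((2 ^ P)⁻¹) := by gcongr; exact not_lt.1 hcon
      _ = 1 := by
        rw [← ENNReal.ofReal_mul (by positivity), mul_inv_cancel₀ (by positivity)]; simp

lemma iUnion_inter_cube {n : ℕ} {F : Set (RCube n)} (hF : PairwiseDisjointCubes F)
    (T : RCube n → Set (Fin n → ℝ)) (B : RCube n) (hB : B ∈ F) :
    (⋃ Q ∈ F, Q.toSet ∩ T Q) ∩ B.toSet = B.toSet ∩ T B := by
  ext x
  simp only [mem_inter_iff, mem_iUnion]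
  constructor
  · rintro ⟨⟨Q, hQ, hxQ, hxT⟩, hxB⟩
    have : Q = B := by
      by_contra hne
      exact disjoint_left.1 (hF hQ hB hne) hxQ hxB
    subst this
    exact ⟨hxB, hxT⟩
  · rintro ⟨h1, h2⟩
    exact ⟨⟨B, hB, h1, h2⟩, h1⟩

lemma nu_apply {n : ℕ} (p : (Fin n → ℝ) → ℝ) (u : ℝ) {A : Set (Fin n → ℝ)} (hA : MeasurableSet A) :
    nu p u A = ∫⁻ x in A, ENNReal.ofReal (u ^ p x) := by
  rw [nu, withDensity_apply _ hA]

lemma layer {n : ℕ} {p : (Fin n → ℝ) → ℝ} (hpm : Measurable p) (u κ κ0 a : ℝ) (hu : 0 < u)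
    (hκ : 0 ≤ κ) (hκ0 : κ ≤ κ0) (ha : 0 < a) (B : Set (Fin n → ℝ)) (hB : MeasurableSet B) :
    nu p (u ^ (1 + κ)) B ≤ ENNReal.ofReal (a ^ κ) * (nu p u B +
      ∑' l : ℕ, ENNReal.ofReal ((3 ^ κ0) ^ (l + 1)) * nu p u (B ∩ {x | 3 ^ l * a ≤ u ^ p x})) := by
  have hTm : ∀ l : ℕ, MeasurableSet {x | 3 ^ l * a ≤ u ^ p x} := fun l =>
    measurableSet_le measurable_const (Measurable.pow measurable_const hpm)
  have hV := nu_dens_meas hpm u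
  set V : (Fin n → ℝ) → ℝ≥0∞ := fun x => ENNReal.ofReal (u ^ p x) with hVd
  have e : ∀ l : ℕ, nu p u (B ∩ {x | 3 ^ l * a ≤ u ^ p x}) =
      ∫⁻ x in B, {x | 3 ^ l * a ≤ u ^ p x}.indicator V x := by
    intro l
    rw [lintegral_indicator (hTm l), Measure.restrict_restrict (hTm l), inter_comm,
      nu_apply p u ((hTm l).inter hB)]
  have e2 : ENNReal.ofReal (a ^ κ) * (nu p u B +
      ∑' l : ℕ, ENNReal.ofReal ((3 ^ κ0) ^ (l + 1)) * nu p u (B ∩ {x | 3 ^ l * a ≤ u ^ p x})) =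
      ∫⁻ x in B, ENNReal.ofReal (a ^ κ) * (V x + ∑' l : ℕ, ENNReal.ofReal ((3 ^ κ0) ^ (l + 1)) *
        {x | 3 ^ l * a ≤ u ^ p x}.indicator V x) := by
    have hm : ∀ l : ℕ, Measurable fun x => ENNReal.ofReal ((3 ^ κ0) ^ (l + 1)) *
        {x | 3 ^ l * a ≤ u ^ p x}.indicator V x := fun l =>
      (hV.indicator (hTm l)).const_mul _
    have hm2 : Measurable fun x => V x + ∑' l : ℕ, ENNReal.ofReal ((3 ^ κ0) ^ (l + 1)) *
        {x | 3 ^ l * a ≤ u ^ p x}.indicator V x := hV.add (Measurable.tsum hm)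
    rw [lintegral_const_mul _ hm2, lintegral_add_left hV,
      lintegral_tsum (fun l => (hm l).aemeasurable), nu_apply p u hB]
    congr 3
    funext l
    rw [lintegral_const_mul _ (hV.indicator (hTm l)), e l]
  rw [e2, nu_apply p _ hB]
  refine lintegral_mono fun x => ?_
  set v := u ^ p x with hv
  have hv0 : 0 < v := by positivity
  have e3 : (u ^ (1 + κ)) ^ p x = v ^ κ * v := by
    rw [← Real.rpow_mul hu.le, mul_comm, Real.rpow_mul hu.le, Real.rpow_add hv0, Real.rpow_one,
      mul_comm]
  rw [e3]
  rcases le_or_gt v a with h | h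
  · calc ENNReal.ofReal (v ^ κ * v) ≤ ENNReal.ofReal (a ^ κ * v) := by
          apply ENNReal.ofReal_le_ofReal; gcongr
      _ = ENNReal.ofReal (a ^ κ) * V x := by rw [ENNReal.ofReal_mul (by positivity)]
      _ ≤ _ := by gcongr; exact le_self_add
  · obtain ⟨l, hl1, hl2⟩ := exists_nat_pow_near (x := v / a) (y := 3)
      (by rw [le_div_iff₀ ha]; linarith) (by norm_num)
    rw [le_div_iff₀ ha] at hl1
    rw [div_lt_iff₀ ha] at hl2
    have hmem : x ∈ {x | 3 ^ l * a ≤ u ^ p x} := hl1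
    calc ENNReal.ofReal (v ^ κ * v) ≤ ENNReal.ofReal (a ^ κ * ((3 ^ κ0) ^ (l + 1) * v)) := by
          apply ENNReal.ofReal_le_ofReal
          rw [← mul_assoc]
          gcongr
          calc v ^ κ ≤ (3 ^ (l+1) * a) ^ κ := by gcongr
            _ = a ^ κ * (3 ^ κ) ^ (l+1) := by
              rw [Real.mul_rpow (by positivity) ha.le, ← Real.rpow_natCast, ← Real.rpow_natCast,
                ← Real.rpow_mul (by norm_num), ← Real.rpow_mul (by norm_num), mul_comm κ, mul_comm]
            _ ≤ _ := by
              gcongr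
              norm_num
      _ = ENNReal.ofReal (a ^ κ) * (ENNReal.ofReal ((3 ^ κ0) ^ (l + 1)) *
            {x | 3 ^ l * a ≤ u ^ p x}.indicator V x) := by
          rw [indicator_of_mem hmem, ENNReal.ofReal_mul (by positivity),
            ENNReal.ofReal_mul (by positivity)]
      _ ≤ _ := by
          gcongr
          refine le_trans ?_ le_add_self
          exact ENNReal.le_tsum (f := fun l : ℕ => ENNReal.ofReal ((3 ^ κ0) ^ (l + 1)) *
            {x | 3 ^ l * a ≤ u ^ p x}.indicator V x) l

lemma cubeU_inter_sub {n : ℕ} (F : Set (RCube n)) (T : RCube n → Set (Fin n → ℝ)) :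
    (⋃ Q ∈ F, Q.toSet ∩ T Q) ⊆ cubeU F :=
  iUnion₂_mono fun _ _ => inter_subset_left

lemma cubeU_inter_meas {n : ℕ} {F : Set (RCube n)} (hF : F.Countable)
    (T : RCube n → Set (Fin n → ℝ)) (hT : ∀ Q, MeasurableSet (T Q)) :
    MeasurableSet (⋃ Q ∈ F, Q.toSet ∩ T Q) :=
  MeasurableSet.biUnion hF fun Q _ => Q.meas.inter (hT Q)

lemma cubeU_inter_measure {n : ℕ} {F : Set (RCube n)} (hF : PairwiseDisjointCubes F)
    (μ : Measure (Fin n → ℝ)) (T : RCube n → Set (Fin n → ℝ)) (hT : ∀ Q, MeasurableSet (T Q)) :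
    μ (⋃ Q ∈ F, Q.toSet ∩ T Q) = ∑' Q : F, μ (Q.1.toSet ∩ T Q.1) := by
  have h := cubeU_measure hF μ _ (cubeU_inter_meas hF.countable T hT)
  rw [inter_eq_self_of_subset_left (cubeU_inter_sub F T)] at h
  rw [h]
  congr 1
  funext Q
  rw [iUnion_inter_cube hF T Q.1 Q.2]

/-- average of the density -/
def avg {n : ℕ} (p : (Fin n → ℝ) → ℝ) (u : ℝ) (B : RCube n) : ℝ :=
  (nu p u B.toSet / volume B.toSet).toReal

lemma avg_spec {n : ℕ} {p : (Fin n → ℝ) → ℝ} {u : ℝ} {B : RCube n} (h : nu p u B.toSet ≠ ∞) :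
    nu p u B.toSet = ENNReal.ofReal (avg p u B) * volume B.toSet := by
  rw [avg, ENNReal.ofReal_toReal (ENNReal.div_ne_top h B.vol_ne_zero),
    ENNReal.div_mul_cancel B.vol_ne_zero B.vol_ne_top]

lemma avg_pos {n : ℕ} {p : (Fin n → ℝ) → ℝ} {u : ℝ} {B : RCube n} (h : nu p u B.toSet ≠ ∞)
    (h0 : nu p u B.toSet ≠ 0) : 0 < avg p u B :=
  ENNReal.toReal_pos (ENNReal.div_ne_zero.2 ⟨h0, B.vol_ne_top⟩) (ENNReal.div_ne_top h B.vol_ne_zero)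

lemma markov {n : ℕ} {p : (Fin n → ℝ) → ℝ} (hpm : Measurable p) {u : ℝ} {B : RCube n}
    (h : nu p u B.toSet ≠ ∞)
    (h0 : nu p u B.toSet ≠ 0) (l : ℕ) :
    volume (B.toSet ∩ {x | 3 ^ l * avg p u B ≤ u ^ p x}) ≤
      ENNReal.ofReal ((3 ^ l)⁻¹) * volume B.toSet := by
  set a := avg p u B with ha
  have ha0 : 0 < a := avg_pos h h0
  have hT : MeasurableSet {x | 3 ^ l * a ≤ u ^ p x} :=
    measurableSet_le measurable_const (Measurable.pow measurable_const hpm)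
  have h1 : ENNReal.ofReal (3 ^ l * a) * volume (B.toSet ∩ {x | 3 ^ l * a ≤ u ^ p x}) ≤
      ENNReal.ofReal a * volume B.toSet := by
    rw [← avg_spec h, nu_apply p u B.meas]
    calc ENNReal.ofReal (3 ^ l * a) * volume (B.toSet ∩ {x | 3 ^ l * a ≤ u ^ p x})
        = ∫⁻ x in B.toSet ∩ {x | 3 ^ l * a ≤ u ^ p x}, ENNReal.ofReal (3 ^ l * a) := by
          rw [setLIntegral_const]
      _ ≤ ∫⁻ x in B.toSet ∩ {x | 3 ^ l * a ≤ u ^ p x}, ENNReal.ofReal (u ^ p x) := by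
          refine setLIntegral_mono' (B.meas.inter hT) fun x hx => ?_
          exact ENNReal.ofReal_le_ofReal hx.2
      _ ≤ _ := lintegral_mono_set inter_subset_left
  have h2 : ENNReal.ofReal (3 ^ l * a) * (ENNReal.ofReal ((3 ^ l)⁻¹) * volume B.toSet) =
      ENNReal.ofReal a * volume B.toSet := by
    rw [← mul_assoc, ← ENNReal.ofReal_mul (by positivity)]
    congr 2
    field_simp
  rw [← h2] at h1
  exact (ENNReal.mul_le_mul_iff_right (by simp; positivity) ENNReal.ofReal_ne_top).1 h1

/-- F1 estimate -/
lemma bound_F1 {n : ℕ} {p : (Fin n → ℝ) → ℝ} (hpm : Measurable p) {θ : ℝ} (hθ : 1 < θ)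
    (hdec : ∀ F : Set (RCube n), PairwiseDisjointCubes F →
      ∀ (u : ℝ), 0 < u → nu p u (cubeU F) ≤ 1 → ∀ (l : ℕ) (H : Set (Fin n → ℝ)),
      MeasurableSet H → H ⊆ cubeU F →
      (∀ B ∈ F, volume (H ∩ B.toSet) ≤ ENNReal.ofReal ((3 ^ l)⁻¹) * volume B.toSet) →
      nu p u H ≤ ENNReal.ofReal ((θ ^ l)⁻¹)) {κ0 : ℝ} (hκθ : (3:ℝ) ^ κ0 < θ) (hκ00 : 0 < κ0) :
    ∃ C2 : ℝ, 0 < C2 ∧ ∀ F1 : Set (RCube n), PairwiseDisjointCubes F1 →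
      ∀ u κ K2 : ℝ, 0 < u → 0 ≤ κ → κ ≤ κ0 → 0 ≤ K2 → nu p u (cubeU F1) ≤ 1 →
      (∀ B ∈ F1, nu p u B.toSet ≠ 0) →
      (∀ B ∈ F1, ENNReal.ofReal K2 * (ENNReal.ofReal (avg p u B ^ κ) * nu p u B.toSet)
        ≤ nu p (u ^ (1 + κ)) B.toSet) →
      ENNReal.ofReal K2 * nu p u (cubeU F1) ≤ ENNReal.ofReal C2 := by
  set r : ℝ := 3 ^ κ0 / θ with hr
  have hr0 : 0 ≤ r := by positivity
  have hr1 : r < 1 := by rw [hr, div_lt_one (by linarith)]; exact hκθ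
  set W : ℝ := 3 ^ κ0 * (1 - r)⁻¹ with hW
  have hW0 : 0 ≤ W := mul_nonneg (by positivity) (inv_nonneg.2 (by linarith))
  refine ⟨1 + W, by linarith, ?_⟩
  intro F1 hF1 u κ K2 hu hκ hκ0 hK2 h1 hne hB
  have hfin : ∀ B ∈ F1, nu p u B.toSet ≠ ∞ := fun B hB =>
    ne_top_of_le_ne_top (by simp : (1:ℝ≥0∞) ≠ ∞)
      ((measure_mono (subset_biUnion_of_mem (u := fun Q : RCube n => Q.toSet) hB)).trans h1)
  set T : ℕ → RCube n → Set (Fin n → ℝ) := fun l B => {x | 3 ^ l * avg p u B ≤ u ^ p x} with hT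
  have hTm : ∀ l B, MeasurableSet (T l B) := fun l B =>
    measurableSet_le measurable_const (Measurable.pow measurable_const hpm)
  have hper : ∀ B ∈ F1, ENNReal.ofReal K2 * nu p u B.toSet ≤ nu p u B.toSet +
      ∑' l : ℕ, ENNReal.ofReal ((3 ^ κ0) ^ (l + 1)) * nu p u (B.toSet ∩ T l B) := by
    intro B hBF
    have ha := avg_pos (hfin B hBF) (hne B hBF)
    have h2 := (hB B hBF).trans (layer hpm u κ κ0 (avg p u B) hu hκ hκ0 ha B.toSet B.meas)
    rw [mul_left_comm] at h2
    exact (ENNReal.mul_le_mul_iff_right (by simp; positivity) (by simp)).1 h2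
  have hH : ∀ l : ℕ, nu p u (⋃ Q ∈ F1, Q.toSet ∩ T l Q) ≤ ENNReal.ofReal ((θ ^ l)⁻¹) := by
    intro l
    refine hdec F1 hF1 u hu h1 l _ (cubeU_inter_meas hF1.countable _ (hTm l))
      (cubeU_inter_sub _ _) fun B hBF => ?_
    rw [iUnion_inter_cube hF1 _ B hBF]
    exact markov hpm (hfin B hBF) (hne B hBF) l
  calc ENNReal.ofReal K2 * nu p u (cubeU F1)
      = ∑' B : F1, ENNReal.ofReal K2 * nu p u B.1.toSet := by
        rw [cubeU_measure' hF1, ENNReal.tsum_mul_left]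
    _ ≤ ∑' B : F1, (nu p u B.1.toSet +
      ∑' l : ℕ, ENNReal.ofReal ((3 ^ κ0) ^ (l + 1)) * nu p u (B.1.toSet ∩ T l B.1)) :=
        ENNReal.tsum_le_tsum fun B => hper B.1 B.2
    _ = nu p u (cubeU F1) + ∑' l : ℕ, ENNReal.ofReal ((3 ^ κ0) ^ (l + 1)) *
          nu p u (⋃ Q ∈ F1, Q.toSet ∩ T l Q) := by
        rw [ENNReal.tsum_add, cubeU_measure' hF1, ENNReal.tsum_comm]
        congr 2
        funext l
        rw [ENNReal.tsum_mul_left, cubeU_inter_measure hF1 _ _ (hTm l)]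
    _ ≤ 1 + ∑' l : ℕ, ENNReal.ofReal ((3 ^ κ0) ^ (l + 1)) * ENNReal.ofReal ((θ ^ l)⁻¹) := by
        gcongr with l
        exact hH l
    _ = 1 + ∑' l : ℕ, ENNReal.ofReal (3 ^ κ0 * r ^ l) := by
        congr 2
        funext l
        rw [← ENNReal.ofReal_mul (by positivity)]
        congr 1
        rw [hr, div_pow, pow_succ]; field_simp
    _ = 1 + ENNReal.ofReal W := by
        rw [← ENNReal.ofReal_tsum_of_nonneg (fun l => by positivity)
          ((summable_geometric_of_lt_one hr0 hr1).mul_left _), tsum_mul_left,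
          tsum_geometric_of_lt_one hr0 hr1]
    _ = ENNReal.ofReal (1 + W) := by
        rw [ENNReal.ofReal_add (by norm_num) hW0]; simp

lemma bad_bound {n : ℕ} {p : (Fin n → ℝ) → ℝ} (hpm : Measurable p) (hp1 : ∀ x, 1 ≤ p x) {P : ℝ}
    (hP : ∀ x, p x ≤ P) (hall : ∀ η : ℝ, 0 < η → ∃ C', PP p η C') (τ : ℝ) (hτ : 0 < τ) :
    ∃ K0 δ : ℝ, 0 < K0 ∧ 0 < δ ∧ ∀ α : ℝ, 0 < α → α < 1 → ∀ F : Set (RCube n),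
      PairwiseDisjointCubes F → ∀ m : RCube n → ℝ,
      (∀ B ∈ F, ENNReal.ofReal τ * volume B.toSet ≤ volume (B.toSet ∩ {x | m B ≤ p x})) →
      (∀ B ∈ F, ENNReal.ofReal (K0 * α ^ m B) * volume B.toSet < nu p α B.toSet) →
      nu p α (cubeU F) ≤ 1 → nu p α (cubeU F) ≤ ENNReal.ofReal (α ^ δ) := by
  obtain ⟨θ, hθ, hdec⟩ := decay hpm hp1 hP hall
  set κ0 : ℝ := Real.log θ / (2 * Real.log 3) with hκ0d
  have hlog3 : 0 < Real.log 3 := Real.log_pos (by norm_num)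
  have hlogθ : 0 < Real.log θ := Real.log_pos hθ
  have hκ00 : 0 < κ0 := by positivity
  have hκθ : (3:ℝ) ^ κ0 < θ := by
    rw [← Real.log_lt_log_iff (by positivity) (by linarith), Real.log_rpow (by norm_num), hκ0d]
    field_simp
    linarith
  obtain ⟨C2, hC2, hF1b⟩ := bound_F1 hpm hθ hdec hκθ hκ00
  set σ : ℝ := (2 ^ P)⁻¹ with hσ
  have hσ0 : 0 < σ := by positivity
  set K2 : ℝ := 3 * C2 / σ with hK2
  have hK20 : 0 < K2 := by positivity
  obtain ⟨C, hC⟩ := hall τ hτ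
  obtain ⟨c, hc, hcs⟩ := small_of hpm hp1 hP C (σ / 3) (by positivity)
  set ε : ℝ := min 1 c with hε
  have hε0 : 0 < ε := lt_min one_pos hc
  have hε1 : ε ≤ 1 := min_le_left _ _
  have hδ0 : 0 < κ0 / (1 + κ0) := by positivity
  refine ⟨K2 / ε ^ (1 + κ0), κ0 / (1 + κ0), by positivity, hδ0, ?_⟩
  set δ : ℝ := κ0 / (1 + κ0) with hδ
  intro α hα hα1 F hF m hm hbad hF1
  by_contra hcon
  have hcon' := not_le.1 hcon
  have hδ1 : 1 - δ = 1 / (1 + κ0) := by rw [hδ]; field_simp; ring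
  have hw1 : 1 < nu p (α ^ (1 - δ)) (cubeU F) := by
    have e : α ^ (1 - δ) = α ^ (-δ) * α := by
      rw [sub_eq_add_neg, add_comm, Real.rpow_add hα, Real.rpow_one]
    have h1 := nu_scale_ge hpm hp1 hα (c := α ^ (-δ))
      (Real.one_le_rpow_of_pos_of_le_one_of_nonpos hα hα1.le (by linarith)) (cubeU F)
    rw [e]
    refine lt_of_lt_of_le ?_ h1
    have hpos : 0 < α ^ (-δ) := by positivity
    calc (1 : ℝ≥0∞) = ENNReal.ofReal (α ^ (-δ)) * ENNReal.ofReal (α ^ δ) := by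
          rw [← ENNReal.ofReal_mul (by positivity), ← Real.rpow_add hα]; simp
      _ < _ := by
          rw [ENNReal.mul_lt_mul_iff_right (by simpa using hpos) (by simp)]
          exact hcon'
  obtain ⟨u, hαu, huw, hu1, hu2⟩ := exists_scale hpm hp1 hP (cubeU F) α _ hα hF1 hw1 (by positivity)
  have hu0 : 0 < u := lt_of_lt_of_le hα hαu
  have hult : u < 1 := lt_of_le_of_lt huw (Real.rpow_lt_one hα.le hα1 (by rw [hδ1]; positivity))
  have hlu : Real.log u < 0 := Real.log_neg hu0 hult
  have hla : Real.log α < 0 := Real.log_neg hα hα1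
  set κ : ℝ := Real.log α / Real.log u - 1 with hκd
  have hακ : α = u ^ (1 + κ) := by
    rw [Real.rpow_def_of_pos hu0, hκd]
    have : Real.log u * (1 + (Real.log α / Real.log u - 1)) = Real.log α := by
      field_simp [hlu.ne]; ring
    rw [this, Real.exp_log hα]
  have hlau : Real.log α ≤ Real.log u := Real.log_le_log hα hαu
  have hluw : Real.log u ≤ (1 - δ) * Real.log α := by
    have := Real.log_le_log hu0 huw
    rwa [Real.log_rpow hα] at this
  have hκ : 0 ≤ κ := by
    rw [hκd, sub_nonneg, le_div_iff_of_neg hlu]; linarith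
  have hκκ0 : κ ≤ κ0 := by
    rw [hκd, sub_le_iff_le_add, div_le_iff_of_neg hlu]
    rw [hδ1] at hluw
    have h3 : (1 + κ0) * Real.log u ≤ (1 + κ0) * (1 / (1 + κ0) * Real.log α) := by gcongr
    have h4 : (1 + κ0) * (1 / (1 + κ0) * Real.log α) = Real.log α := by field_simp
    rw [h4] at h3
    linarith
  have hne : ∀ B ∈ F, nu p u B.toSet ≠ 0 := fun B hB =>
    (lt_of_lt_of_le (lt_of_le_of_lt zero_le (hbad B hB)) (nu_mono hp1 hα hαu _)).ne'
  have hfin : ∀ B ∈ F, nu p u B.toSet ≠ ∞ := fun B hB =>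
    ne_top_of_le_ne_top (by simp : (1:ℝ≥0∞) ≠ ∞)
      ((measure_mono (subset_biUnion_of_mem (u := fun Q : RCube n => Q.toSet) hB)).trans hu1)
  set F1 : Set (RCube n) := {B ∈ F | ENNReal.ofReal K2 *
    (ENNReal.ofReal (avg p u B ^ κ) * nu p u B.toSet) ≤ nu p (u ^ (1 + κ)) B.toSet} with hF1d
  have hF1s : F1 ⊆ F := sep_subset _ _
  set F2 : Set (RCube n) := F \ F1 with hF2d
  have hF2s : F2 ⊆ F := sdiff_subset
  have hcu : ∀ {F' : Set (RCube n)}, F' ⊆ F → cubeU F' ⊆ cubeU F := fun h =>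
    biUnion_subset_biUnion_left h
  have b1 : nu p u (cubeU F1) ≤ ENNReal.ofReal (σ / 3) := by
    have := hF1b F1 (hF.subset hF1s) u κ K2 hu0 hκ hκκ0 hK20.le
      ((measure_mono (hcu hF1s)).trans hu1) (fun B hB => hne B (hF1s hB)) (fun B hB => hB.2)
    have e : ENNReal.ofReal C2 = ENNReal.ofReal K2 * ENNReal.ofReal (σ / 3) := by
      rw [← ENNReal.ofReal_mul hK20.le]; congr 1; rw [hK2]; field_simp
    rw [e] at this
    exact (ENNReal.mul_le_mul_iff_right (by simpa using hK20) (by simp)).1 this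
  have hTm : ∀ B : RCube n, MeasurableSet {x | m B ≤ p x} := fun B =>
    measurableSet_le measurable_const hpm
  have b2 : nu p u (cubeU F2) ≤ ENNReal.ofReal (σ / 3) := by
    have hF2 := hF.subset hF2s
    refine hcs (⋃ B ∈ F2, B.toSet ∩ {x | m B ≤ p x}) (cubeU F2) ?_ u hu0 ?_
    · intro v hv hv1
      refine hC v hv F2 hF2 _ (cubeU_inter_meas hF2.countable _ hTm) (fun B hB => ?_) hv1
      rw [iUnion_inter_cube hF2 _ B hB]
      exact hm B (hF2s hB)
    · have hper : ∀ B ∈ F2, nu p u (B.toSet ∩ {x | m B ≤ p x}) ≤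
          ENNReal.ofReal ε * nu p u B.toSet := by
        intro B hB
        have hBF := hF2s hB
        have ha := avg_pos (hfin B hBF) (hne B hBF)
        have hsp := avg_spec (hfin B hBF)
        set a := avg p u B with had
        have h1 : nu p (u ^ (1 + κ)) B.toSet < ENNReal.ofReal K2 *
            (ENNReal.ofReal (a ^ κ) * nu p u B.toSet) := by
          by_contra hh
          exact hB.2 ⟨hBF, not_lt.1 hh⟩
        have h2 := hbad B hBF
        have h3 : ENNReal.ofReal (K2 / ε ^ (1 + κ0) * α ^ m B) * volume B.toSet ≤
            ENNReal.ofReal (K2 * (a ^ κ * a)) * volume B.toSet := by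
          refine (h2.trans ?_).le
          rw [hακ]
          refine h1.trans_eq ?_
          rw [hsp, ENNReal.ofReal_mul hK20.le, ENNReal.ofReal_mul (by positivity)]
          ring
        rw [ENNReal.mul_le_mul_iff_left B.vol_ne_zero B.vol_ne_top,
          ENNReal.ofReal_le_ofReal_iff (by positivity)] at h3
        have h4 : α ^ m B = (u ^ m B) ^ (1 + κ) := by
          rw [hακ, ← Real.rpow_mul hu0.le, ← Real.rpow_mul hu0.le, mul_comm]
        have h5 : a ^ κ * a = a ^ (1 + κ) := by
          rw [Real.rpow_add ha, Real.rpow_one, mul_comm]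
        have h6 : (u ^ m B) ^ (1 + κ) ≤ (ε * a) ^ (1 + κ) := by
          rw [h4, h5, div_mul_eq_mul_div, div_le_iff₀ (by positivity), mul_assoc] at h3
          have h7 := le_of_mul_le_mul_left h3 hK20
          rw [Real.mul_rpow hε0.le ha.le]
          refine h7.trans ?_
          rw [mul_comm]
          gcongr ?_ * _
          exact Real.rpow_le_rpow_of_exponent_ge hε0 hε1 (by linarith)
        have h8 : u ^ m B ≤ ε * a :=
          (Real.rpow_le_rpow_iff (by positivity) (by positivity) (by linarith)).1 h6
        rw [nu_apply p u (B.meas.inter (hTm B))]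
        calc ∫⁻ x in B.toSet ∩ {x | m B ≤ p x}, ENNReal.ofReal (u ^ p x)
            ≤ ∫⁻ x in B.toSet ∩ {x | m B ≤ p x}, ENNReal.ofReal (ε * a) := by
              refine setLIntegral_mono' (B.meas.inter (hTm B)) fun x hx => ?_
              refine ENNReal.ofReal_le_ofReal (le_trans ?_ h8)
              exact Real.rpow_le_rpow_of_exponent_ge hu0 hult.le hx.2
          _ = ENNReal.ofReal (ε * a) * volume (B.toSet ∩ {x | m B ≤ p x}) := by
              rw [setLIntegral_const]
          _ ≤ ENNReal.ofReal (ε * a) * volume B.toSet := by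
              gcongr; exact inter_subset_left
          _ = _ := by rw [hsp, ENNReal.ofReal_mul hε0.le, mul_assoc]
      rw [cubeU_inter_measure hF2 _ _ hTm]
      calc ∑' Q : F2, nu p u (Q.1.toSet ∩ {x | m Q.1 ≤ p x})
          ≤ ∑' Q : F2, ENNReal.ofReal ε * nu p u Q.1.toSet :=
            ENNReal.tsum_le_tsum fun Q => hper Q.1 Q.2
        _ = ENNReal.ofReal ε * nu p u (cubeU F2) := by
            rw [ENNReal.tsum_mul_left, cubeU_measure' hF2]
        _ ≤ ENNReal.ofReal ε * 1 := by
            gcongr; exact (measure_mono (hcu hF2s)).trans hu1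
        _ ≤ _ := by rw [mul_one]; exact ENNReal.ofReal_le_ofReal (min_le_right _ _)
  have b3 : nu p u (cubeU F) ≤ ENNReal.ofReal (σ / 3 + σ / 3) := by
    rw [ENNReal.ofReal_add (by positivity) (by positivity)]
    refine le_trans ?_ (add_le_add b1 b2)
    refine (measure_mono ?_).trans (measure_union_le _ _)
    intro x hx
    simp only [cubeU, mem_iUnion] at hx
    obtain ⟨B, hB, hx⟩ := hx
    by_cases h : B ∈ F1
    · exact Or.inl (mem_biUnion h hx)
    · exact Or.inr (mem_biUnion (show B ∈ F2 from ⟨hB, h⟩) hx)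
  have b4 := hu2.trans_le b3
  rw [ENNReal.ofReal_lt_ofReal_iff (by positivity)] at b4
  linarith

lemma good_cube {n : ℕ} {p : (Fin n → ℝ) → ℝ} (α τ y : ℝ) (hτ : 0 < τ) (hτ1 : τ < 1)
    (hy : 0 ≤ y) (B : RCube n)
    (G T : Set (Fin n → ℝ)) (hG : MeasurableSet G) (hT : MeasurableSet T)
    (h1 : ENNReal.ofReal τ * volume B.toSet ≤ volume (G ∩ B.toSet))
    (h2 : ENNReal.ofReal (1 - τ / 2) * volume B.toSet ≤ volume (B.toSet ∩ T))
    (h3 : ∀ x ∈ T, y ≤ α ^ p x) :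
    ENNReal.ofReal (y * (τ / 2)) * volume B.toSet ≤ nu p α (G ∩ B.toSet) := by
  have hfin : ∀ A : Set (Fin n → ℝ), volume (B.toSet ∩ A) ≠ ∞ := fun A =>
    ne_top_of_le_ne_top B.vol_ne_top (measure_mono inter_subset_left)
  have k : ENNReal.ofReal (τ / 2) * volume B.toSet ≤ volume (B.toSet ∩ (G ∩ T)) := by
    have k1 := measure_union_add_inter (μ := volume) (B.toSet ∩ G) (B.meas.inter hT)
    have k2 : volume (B.toSet ∩ G ∪ B.toSet ∩ T) ≤ volume B.toSet :=
      measure_mono (union_subset inter_subset_left inter_subset_left)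
    have k3 : B.toSet ∩ G ∩ (B.toSet ∩ T) = B.toSet ∩ (G ∩ T) := by ext x; simp; tauto
    rw [k3] at k1
    rw [inter_comm G] at h1
    have k4 : ENNReal.ofReal (τ / 2) * volume B.toSet + volume B.toSet =
        ENNReal.ofReal τ * volume B.toSet + ENNReal.ofReal (1 - τ / 2) * volume B.toSet := by
      rw [← add_mul, ← ENNReal.ofReal_add hτ.le (by linarith)]
      nth_rewrite 2 [← one_mul (volume B.toSet)]
      rw [← add_mul, ← ENNReal.ofReal_one, ← ENNReal.ofReal_add (by linarith) (by norm_num)]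
      congr 2; ring
    refine (ENNReal.add_le_add_iff_right B.vol_ne_top).1 ?_
    rw [k4]
    calc _ ≤ volume (B.toSet ∩ G) + volume (B.toSet ∩ T) := add_le_add h1 h2
      _ = _ := k1.symm
      _ ≤ _ := by rw [add_comm]; gcongr
  calc ENNReal.ofReal (y * (τ / 2)) * volume B.toSet
      = ENNReal.ofReal y * (ENNReal.ofReal (τ / 2) * volume B.toSet) := by
        rw [ENNReal.ofReal_mul hy, mul_assoc]
    _ ≤ ENNReal.ofReal y * volume (B.toSet ∩ (G ∩ T)) := by gcongr
    _ = ∫⁻ x in B.toSet ∩ (G ∩ T), ENNReal.ofReal y := by rw [setLIntegral_const]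
    _ ≤ ∫⁻ x in B.toSet ∩ (G ∩ T), ENNReal.ofReal (α ^ p x) :=
        setLIntegral_mono' (B.meas.inter (hG.inter hT)) fun x hx =>
          ENNReal.ofReal_le_ofReal (h3 x hx.2.2)
    _ ≤ ∫⁻ x in G ∩ B.toSet, ENNReal.ofReal (α ^ p x) :=
        lintegral_mono_set fun x hx => ⟨hx.2.1, hx.1⟩
    _ = _ := (nu_apply p α (hG.inter B.meas)).symm

lemma small_alpha {n : ℕ} {p : (Fin n → ℝ) → ℝ} (hpm : Measurable p) (hp1 : ∀ x, 1 ≤ p x) {P : ℝ}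
    (hP : ∀ x, p x ≤ P) (hall : ∀ η : ℝ, 0 < η → ∃ C', PP p η C') (τ : ℝ) (hτ : 0 < τ)
    (hτ1 : τ < 1) :
    ∃ K c0 δ : ℝ, 0 < K ∧ 0 < c0 ∧ 0 < δ ∧ ∀ α : ℝ, 0 < α → α < 1 → ∀ F : Set (RCube n),
      PairwiseDisjointCubes F → ∀ G : Set (Fin n → ℝ), MeasurableSet G →
      (∀ B ∈ F, ENNReal.ofReal τ * volume B.toSet ≤ volume (G ∩ B.toSet)) →
      nu p α G ≤ ENNReal.ofReal c0 →
      nu p α (cubeU F) ≤ ENNReal.ofReal K * nu p α G + ENNReal.ofReal (α ^ δ) := by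
  obtain ⟨K0, δ, hK0, hδ, hbad⟩ := bad_bound hpm hp1 hP hall (τ / 2) (by positivity)
  obtain ⟨C, hC⟩ := hall τ hτ
  obtain ⟨c0, hc0, hcs⟩ := small_of hpm hp1 hP C 1 one_pos
  refine ⟨K0 * (2 / τ), c0, δ, by positivity, hc0, hδ, ?_⟩
  intro α hα hα1 F hF G hG hGB hG1
  have hle1 : nu p α (cubeU F) ≤ 1 := by
    have := hcs G (cubeU F) (fun u hu h => hC u hu F hF G hG hGB h) α hα hG1
    simpa using this
  choose m hm1 hm2 using fun B : RCube n =>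
    quantile hpm hp1 hP (1 - τ / 2) (by linarith) (by linarith) B
  set F1 : Set (RCube n) := {B ∈ F | nu p α B.toSet ≤ ENNReal.ofReal (K0 * α ^ m B) * volume B.toSet}
    with hF1
  have hF1s : F1 ⊆ F := sep_subset _ _
  have hF2s : F \ F1 ⊆ F := sdiff_subset
  have hsplit : nu p α (cubeU F) ≤ nu p α (cubeU F1) + nu p α (cubeU (F \ F1)) := by
    refine (measure_mono ?_).trans (measure_union_le _ _)
    intro x hx
    simp only [cubeU, mem_iUnion] at hx
    obtain ⟨B, hB, hx⟩ := hx
    by_cases h : B ∈ F1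
    · exact Or.inl (mem_biUnion h hx)
    · exact Or.inr (mem_biUnion (show B ∈ F \ F1 from ⟨hB, h⟩) hx)
  refine hsplit.trans (add_le_add ?_ ?_)
  · have hd := hF.subset hF1s
    have hper : ∀ B ∈ F1, nu p α B.toSet ≤ ENNReal.ofReal (K0 * (2 / τ)) * nu p α (G ∩ B.toSet) := by
      intro B hB
      have := good_cube (p := p) α τ (α ^ m B) hτ hτ1 (by positivity) B G {x | p x ≤ m B} hG
        (measurableSet_le hpm measurable_const) (hGB B (hF1s hB)) (hm1 B)
        (fun x hx => Real.rpow_le_rpow_of_exponent_ge hα hα1.le hx)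
      refine hB.2.trans ?_
      calc ENNReal.ofReal (K0 * α ^ m B) * volume B.toSet
          = ENNReal.ofReal (K0 * (2 / τ)) * (ENNReal.ofReal (α ^ m B * (τ / 2)) * volume B.toSet) := by
            rw [← mul_assoc, ← ENNReal.ofReal_mul (by positivity)]
            congr 2; field_simp
        _ ≤ _ := by gcongr
    calc nu p α (cubeU F1) = ∑' B : F1, nu p α B.1.toSet := cubeU_measure' hd _
      _ ≤ ∑' B : F1, ENNReal.ofReal (K0 * (2 / τ)) * nu p α (G ∩ B.1.toSet) :=
          ENNReal.tsum_le_tsum fun B => hper B.1 B.2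
      _ = ENNReal.ofReal (K0 * (2 / τ)) * nu p α (G ∩ cubeU F1) := by
          rw [ENNReal.tsum_mul_left, cubeU_measure hd _ _ hG]
      _ ≤ _ := by gcongr; exact inter_subset_left
  · refine hbad α hα hα1 (F \ F1) (hF.subset hF2s) m (fun B hB => ?_) (fun B hB => ?_) ?_
    · have := hm2 B
      rwa [show 1 - (1 - τ / 2) = τ / 2 by ring] at this
    · by_contra hh
      exact hB.2 ⟨hB.1, not_lt.1 hh⟩
    · exact (measure_mono (biUnion_subset_biUnion_left hF2s)).trans hle1

lemma cubeU_singleton {n : ℕ} (B : RCube n) : cubeU {B} = B.toSet := by simp [cubeU]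

lemma large_alpha {n : ℕ} {p : (Fin n → ℝ) → ℝ} (hpm : Measurable p) (hp1 : ∀ x, 1 ≤ p x) {P : ℝ}
    (hP : ∀ x, p x ≤ P) (hall : ∀ η : ℝ, 0 < η → ∃ C', PP p η C') (τ : ℝ) (hτ : 0 < τ)
    (hτ1 : τ < 1) :
    ∃ K c0 : ℝ, 0 < K ∧ 0 < c0 ∧ ∀ α : ℝ, 1 ≤ α → ∀ F : Set (RCube n),
      PairwiseDisjointCubes F → ∀ G : Set (Fin n → ℝ), MeasurableSet G →
      (∀ B ∈ F, ENNReal.ofReal τ * volume B.toSet ≤ volume (G ∩ B.toSet)) →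
      nu p α G ≤ ENNReal.ofReal c0 →
      nu p α (cubeU F) ≤ ENNReal.ofReal K * nu p α G := by
  obtain ⟨C, hC⟩ := hall τ hτ
  obtain ⟨c0, hc0, hcs⟩ := small_of hpm hp1 hP C 1 one_pos
  obtain ⟨C', hC'⟩ := hall (τ / 2) (by positivity)
  obtain ⟨c, hc, hcs'⟩ := small_of hpm hp1 hP C' ((2 ^ P)⁻¹) (by positivity)
  refine ⟨(1 + 1 / c) * (2 / τ), c0, by positivity, hc0, ?_⟩
  intro α hα1 F hF G hG hGB hG1
  have hα : 0 < α := by linarith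
  have hper : ∀ B ∈ F, nu p α B.toSet ≤
      ENNReal.ofReal ((1 + 1 / c) * (2 / τ)) * nu p α (G ∩ B.toSet) := by
    intro B hB
    have hsd : PairwiseDisjointCubes {B} := pairwise_singleton _ _
    have hle1 : nu p α B.toSet ≤ 1 := by
      have := hcs G (cubeU {B}) (fun u hu h => hC u hu {B} hsd G hG
        (by rintro Q rfl; exact hGB _ hB) h) α hα hG1
      simpa [cubeU_singleton] using this
    rcases eq_or_ne (nu p α B.toSet) 0 with h0 | h0
    · rw [h0]; exact zero_le
    obtain ⟨m, hm1, hm2⟩ := quantile hpm hp1 hP (τ / 2) (by linarith) (by linarith) B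
    have hgood := good_cube (p := p) α τ (α ^ m) hτ hτ1 (by positivity) B G {x | m ≤ p x} hG
        (measurableSet_le measurable_const hpm) (hGB B hB) hm2
        (fun x hx => Real.rpow_le_rpow_of_exponent_le hα1 hx)
    have hexw : ∃ w : ℝ, 0 < w ∧ 1 < nu p w B.toSet := by
      have hfin : nu p α B.toSet ≠ ∞ := ne_top_of_le_ne_top (by simp) hle1
      have hpos := ENNReal.toReal_pos h0 hfin
      have hle : (nu p α B.toSet).toReal ≤ 1 := by
        simpa using ENNReal.toReal_mono (by simp) hle1
      set y := (nu p α B.toSet).toReal with hy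
      refine ⟨2 / y * α, by positivity, ?_⟩
      refine lt_of_lt_of_le ?_ (nu_scale_ge hpm hp1 hα (by rw [le_div_iff₀ hpos]; linarith) _)
      rw [← ENNReal.ofReal_toReal hfin, ← hy, ← ENNReal.ofReal_mul (by positivity),
        div_mul_cancel₀ _ hpos.ne']
      simp
    obtain ⟨w, hw0, hw⟩ := hexw
    obtain ⟨s, hαs, -, hs1, hs2⟩ := exists_scale hpm hp1 hP B.toSet α w hα hle1 hw hw0
    have hs0 : 0 < s := by linarith
    have hs11 : 1 ≤ s := by linarith
    have hTm : MeasurableSet {x | p x ≤ m} := measurableSet_le hpm measurable_const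
    have hE' : ENNReal.ofReal c ≤ ENNReal.ofReal (s ^ m) * volume B.toSet := by
      have h1 : ENNReal.ofReal c < nu p s (B.toSet ∩ {x | p x ≤ m}) := by
        by_contra hh
        have := hcs' (B.toSet ∩ {x | p x ≤ m}) (cubeU {B}) (fun u hu h => hC' u hu {B} hsd _
          (B.meas.inter hTm) (by
            rintro Q rfl
            rwa [inter_assoc, inter_comm, inter_assoc, inter_self, inter_comm]) h) s hs0 (not_lt.1 hh)
        rw [cubeU_singleton] at this
        exact absurd hs2 (not_lt.2 this)
      refine h1.le.trans ?_
      rw [nu_apply p s (B.meas.inter hTm)]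
      calc ∫⁻ x in B.toSet ∩ {x | p x ≤ m}, ENNReal.ofReal (s ^ p x)
          ≤ ∫⁻ x in B.toSet ∩ {x | p x ≤ m}, ENNReal.ofReal (s ^ m) := by
            refine setLIntegral_mono' (B.meas.inter hTm) fun x hx => ?_
            exact ENNReal.ofReal_le_ofReal (Real.rpow_le_rpow_of_exponent_le hs11 hx.2)
        _ = ENNReal.ofReal (s ^ m) * volume (B.toSet ∩ {x | p x ≤ m}) := by
            rw [setLIntegral_const]
        _ ≤ _ := by gcongr; exact inter_subset_left
    have hup : nu p α B.toSet ≤ ENNReal.ofReal (α ^ m) * volume B.toSet +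
        ENNReal.ofReal ((α / s) ^ m) * nu p s B.toSet := by
      rw [nu_apply p α B.meas, nu_apply p s B.meas, ← lintegral_const_mul _ (nu_dens_meas hpm s),
        ← setLIntegral_const, ← lintegral_add_left measurable_const]
      refine lintegral_mono fun x => ?_
      rw [← ENNReal.ofReal_mul (by positivity), ← ENNReal.ofReal_add (by positivity) (by positivity)]
      apply ENNReal.ofReal_le_ofReal
      rcases le_or_gt (p x) m with h | h
      · have h1 : α ^ p x ≤ α ^ m := Real.rpow_le_rpow_of_exponent_le hα1 h
        have h2 : 0 ≤ (α / s) ^ m * s ^ p x := by positivity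
        linarith
      · have h1 : α ^ p x = (α / s) ^ p x * s ^ p x := by
          rw [← Real.mul_rpow (by positivity) hs0.le, div_mul_cancel₀ _ hs0.ne']
        have h2 : (α / s) ^ p x ≤ (α / s) ^ m :=
          Real.rpow_le_rpow_of_exponent_ge (by positivity) ((div_le_one hs0).2 hαs) h.le
        have h3 : (α / s) ^ p x * s ^ p x ≤ (α / s) ^ m * s ^ p x := by gcongr
        have h4 : 0 ≤ α ^ m := by positivity
        linarith
    have hup2 : ENNReal.ofReal ((α / s) ^ m) * nu p s B.toSet ≤
        ENNReal.ofReal (1 / c * α ^ m) * volume B.toSet := by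
      calc ENNReal.ofReal ((α / s) ^ m) * nu p s B.toSet ≤ ENNReal.ofReal ((α / s) ^ m) * 1 := by
            gcongr
        _ = ENNReal.ofReal (1 / c * (α / s) ^ m) * ENNReal.ofReal c := by
            rw [mul_one, ← ENNReal.ofReal_mul (by positivity)]
            congr 1; field_simp
        _ ≤ ENNReal.ofReal (1 / c * (α / s) ^ m) * (ENNReal.ofReal (s ^ m) * volume B.toSet) := by
            gcongr
        _ = _ := by
            rw [← mul_assoc, ← ENNReal.ofReal_mul (by positivity), mul_assoc,
              ← Real.mul_rpow (by positivity) hs0.le, div_mul_cancel₀ _ hs0.ne']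
    calc nu p α B.toSet ≤ ENNReal.ofReal (α ^ m) * volume B.toSet +
          ENNReal.ofReal (1 / c * α ^ m) * volume B.toSet := hup.trans (by gcongr)
      _ = ENNReal.ofReal ((1 + 1 / c) * (2 / τ)) *
          (ENNReal.ofReal (α ^ m * (τ / 2)) * volume B.toSet) := by
          rw [← add_mul, ← mul_assoc, ← ENNReal.ofReal_mul (by positivity),
            ← ENNReal.ofReal_add (by positivity) (by positivity)]
          congr 2; field_simp
      _ ≤ _ := by gcongr
  calc nu p α (cubeU F) = ∑' B : F, nu p α B.1.toSet := cubeU_measure' hF _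
    _ ≤ ∑' B : F, ENNReal.ofReal ((1 + 1 / c) * (2 / τ)) * nu p α (G ∩ B.1.toSet) :=
        ENNReal.tsum_le_tsum fun B => hper B.1 B.2
    _ = ENNReal.ofReal ((1 + 1 / c) * (2 / τ)) * nu p α (G ∩ cubeU F) := by
        rw [ENNReal.tsum_mul_left, cubeU_measure hF _ _ hG]
    _ ≤ _ := by gcongr; exact inter_subset_left

lemma core {n : ℕ} {p : (Fin n → ℝ) → ℝ} (hpm : Measurable p) (hp1 : ∀ x, 1 ≤ p x) {P : ℝ}
    (hP : ∀ x, p x ≤ P) (hall : ∀ η : ℝ, 0 < η → ∃ C', PP p η C') (t : ℝ) (ht : 0 < t)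
    (ht1 : t < 1) :
    ∃ K c0 δ : ℝ, 0 < K ∧ 0 < c0 ∧ 0 < δ ∧ ∀ α : ℝ, 0 < α →
      ∀ G : Set (Fin n → ℝ), MeasurableSet G → nu p α G ≤ ENNReal.ofReal c0 →
      nu p α (OmA t G) ≤ ENNReal.ofReal K *
        (nu p α G + (if α < 1 then ENNReal.ofReal (α ^ δ) else 0)) := by
  obtain ⟨N, hN⟩ := besi n
  have h2n : (1 : ℝ) ≤ 2 ^ n := one_le_pow₀ (by norm_num)
  have hτ : 0 < t / 2 ^ n := by positivity
  have hτ1 : t / 2 ^ n < 1 := by rw [div_lt_one (by positivity)]; linarith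
  obtain ⟨K1, c1, δ, hK1, hc1, hδ, hs⟩ := small_alpha hpm hp1 hP hall _ hτ hτ1
  obtain ⟨K2, c2, hK2, hc2, hl⟩ := large_alpha hpm hp1 hP hall _ hτ hτ1
  set K : ℝ := 1 + K1 + K2 with hK
  refine ⟨(N + 1) * K, min c1 c2, δ, by positivity, lt_min hc1 hc2, hδ, ?_⟩
  intro α hα G hG hG1
  set err : ℝ≥0∞ := if α < 1 then ENNReal.ofReal (α ^ δ) else 0 with herr
  have key : ∀ F : Set (RCube n), PairwiseDisjointCubes F →
      (∀ B ∈ F, ENNReal.ofReal (t / 2 ^ n) * volume B.toSet ≤ volume (G ∩ B.toSet)) →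
      nu p α (cubeU F) ≤ ENNReal.ofReal K * (nu p α G + err) := by
    intro F hF hGB
    rcases lt_or_ge α 1 with h | h
    · have := hs α hα h F hF G hG hGB
        (hG1.trans (ENNReal.ofReal_le_ofReal (min_le_left _ _)))
      rw [herr, if_pos h, mul_add]
      refine this.trans (add_le_add ?_ ?_)
      · gcongr
        linarith
      · calc ENNReal.ofReal (α ^ δ) = ENNReal.ofReal 1 * ENNReal.ofReal (α ^ δ) := by simp
          _ ≤ _ := by gcongr; linarith
    · have := hl α h F hF G hG hGB
        (hG1.trans (ENNReal.ofReal_le_ofReal (min_le_right _ _)))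
      rw [herr, if_neg (not_lt.2 h), add_zero]
      refine this.trans ?_
      gcongr
      linarith
  refine OmA_measure_le _ _ _ _ fun R => ?_
  obtain ⟨F, hF1, hF2, hF3⟩ := hN t ht G R
  calc nu p α (Om t G R) ≤ nu p α (⋃ i, cubeU (F i)) := measure_mono hF3
    _ ≤ ∑ i, nu p α (cubeU (F i)) := measure_iUnion_fintype_le _ _
    _ ≤ ∑ _i : Fin N, ENNReal.ofReal K * (nu p α G + err) :=
        Finset.sum_le_sum fun i _ => key (F i) (hF1 i) (hF2 i)
    _ = ENNReal.ofReal (N * K) * (nu p α G + err) := by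
        rw [ENNReal.ofReal_mul (by positivity)]; simp [mul_assoc]
    _ ≤ _ := by
        gcongr
        linarith

lemma PP_of_AInfty {n : ℕ} {p : (Fin n → ℝ) → ℝ} (hpm : Measurable p) (hp1 : ∀ x, 1 ≤ p x) {P : ℝ}
    (hP : ∀ x, p x ≤ P) {lam C : ℝ} (hC : 0 < C) (h : AInftyWith p lam C) :
    PP p lam ((C + 1) ^ P) := by
  intro u hu F hF E hE hEQ hE1
  have h1 := h F hF (fun _ => u) (fun _ _ => hu.le) (fun Q => E ∩ Q.toSet)
    (fun Q hQ => ⟨hE.inter Q.meas, inter_subset_right, hEQ Q hQ⟩)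
  have h2 : vnorm p (cubeSum F (fun _ => u) fun Q => E ∩ Q.toSet) ≤ 1 := by
    refine sInf_le ⟨one_pos, le_trans ?_ hE1⟩
    rw [nu_apply p u hE, ← lintegral_indicator hE]
    refine lintegral_mono fun x => ?_
    have hle : cubeSum F (fun _ => u) (fun Q => E ∩ Q.toSet) x ≤
        E.indicator (fun _ => ENNReal.ofReal u) x := by
      refine iSup_le fun Q => iSup_le fun _ => iSup_le fun hx => ?_
      rw [indicator_of_mem hx.1]
    have hp0 : 0 < p x := by linarith [hp1 x]
    rw [div_one]
    refine (ENNReal.rpow_le_rpow hle hp0.le).trans ?_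
    by_cases hx : x ∈ E
    · rw [indicator_of_mem hx, indicator_of_mem hx, ENNReal.ofReal_rpow_of_nonneg hu.le hp0.le]
    · rw [indicator_of_notMem hx, indicator_of_notMem hx, ENNReal.zero_rpow_of_pos hp0]
  have h3 : vnorm p (cubeSum F (fun _ => u) RCube.toSet) < ENNReal.ofReal (C + 1) := by
    refine lt_of_le_of_lt h1 ?_
    calc ENNReal.ofReal C * vnorm p (cubeSum F (fun _ => u) fun Q => E ∩ Q.toSet)
        ≤ ENNReal.ofReal C * 1 := by gcongr
      _ < _ := by
        rw [mul_one]; exact (ENNReal.ofReal_lt_ofReal_iff (by linarith)).2 (by linarith)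
  obtain ⟨l, ⟨hl0, hl1⟩, hl⟩ := sInf_lt_iff.1 h3
  have hUm := cubeU_meas hF.countable
  have h4 : nu p (u / (C + 1)) (cubeU F) ≤ 1 := by
    refine le_trans ?_ hl1
    rw [nu_apply p _ hUm]
    refine le_trans ?_ (setLIntegral_le_lintegral (cubeU F) _)
    refine setLIntegral_mono' hUm fun x hx => ?_
    have hp0 : 0 < p x := by linarith [hp1 x]
    simp only [cubeU, mem_iUnion] at hx
    obtain ⟨Q, hQ, hx⟩ := hx
    rw [← ENNReal.ofReal_rpow_of_nonneg (by positivity) hp0.le]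
    refine ENNReal.rpow_le_rpow ?_ hp0.le
    rw [ENNReal.ofReal_div_of_pos (by positivity)]
    refine ENNReal.div_le_div ?_ hl.le
    exact le_iSup_of_le Q (le_iSup_of_le hQ (le_iSup_of_le hx le_rfl))
  have h5 := nu_scale_le hpm hP (u := u / (C + 1)) (c := C + 1) (by positivity) (by linarith) (cubeU F)
  rw [mul_div_cancel₀ _ (by linarith : C + 1 ≠ 0)] at h5
  refine h5.trans ?_
  calc _ ≤ ENNReal.ofReal ((C + 1) ^ P) * 1 := by gcongr
    _ = _ := mul_one _

/-- dyadic sum below a level -/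
lemma dyadic_sum (g q : ℝ) (hg : 0 ≤ g) (hq : 1 ≤ q) :
    ∑' k : ℤ, (if (2:ℝ) ^ k < g then ENNReal.ofReal (((2:ℝ) ^ k) ^ q) else 0) ≤
      2 * ENNReal.ofReal (g ^ q) := by
  rcases hg.eq_or_lt with h0 | h0
  · have : ∀ k : ℤ, ¬ (2:ℝ) ^ k < g := fun k => by rw [← h0]; exact not_lt.2 (by positivity)
    simp [this]
  obtain ⟨k0, hk0, hk1⟩ := exists_mem_Ioc_zpow h0 (by norm_num : (1:ℝ) < 2)
  set φ : ℤ → ℝ≥0∞ := fun k => if (2:ℝ) ^ k < g then ENNReal.ofReal (((2:ℝ) ^ k) ^ q) else 0 with hφ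
  have hinj : Function.Injective fun j : ℕ => k0 - (j : ℤ) := fun i j h => by
    simp at h; exact h
  have hsup : Function.support φ ⊆ range fun j : ℕ => k0 - (j : ℤ) := by
    intro k hk
    have hkg : (2:ℝ) ^ k < g := by
      by_contra hh
      exact hk (by simp [hφ, hh])
    have : k < k0 + 1 := by
      have := hkg.trans_le hk1
      exact (zpow_lt_zpow_iff_right₀ (by norm_num : (1:ℝ) < 2)).1 this
    exact ⟨(k0 - k).toNat, by simp only; omega⟩
  rw [← hinj.tsum_eq hsup]
  have hle : ∀ j : ℕ, φ (k0 - (j : ℤ)) ≤ ENNReal.ofReal (g ^ q) * ENNReal.ofReal ((1 / 2) ^ j) := by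
    intro j
    rw [← ENNReal.ofReal_mul (by positivity)]
    have : φ (k0 - (j : ℤ)) ≤ ENNReal.ofReal (((2:ℝ) ^ (k0 - (j:ℤ))) ^ q) := by
      simp only [hφ]; split_ifs
      · exact le_rfl
      · exact zero_le
    refine this.trans (ENNReal.ofReal_le_ofReal ?_)
    rw [zpow_sub₀ (by norm_num), div_eq_mul_inv, Real.mul_rpow (by positivity) (by positivity)]
    have e : ((2:ℝ) ^ (j:ℤ))⁻¹ = (1/2) ^ j := by simp
    rw [e]
    gcongr
    calc ((1/2:ℝ) ^ j) ^ q ≤ ((1/2:ℝ) ^ j) ^ (1:ℝ) :=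
          Real.rpow_le_rpow_of_exponent_ge (by positivity) (pow_le_one₀ (by norm_num) (by norm_num)) hq
      _ = _ := Real.rpow_one _
  calc ∑' j : ℕ, φ (k0 - (j : ℤ)) ≤ ∑' j : ℕ, ENNReal.ofReal (g ^ q) * ENNReal.ofReal ((1 / 2) ^ j) :=
        ENNReal.tsum_le_tsum hle
    _ = 2 * ENNReal.ofReal (g ^ q) := by
        rw [ENNReal.tsum_mul_left, ← ENNReal.ofReal_tsum_of_nonneg (fun l => by positivity)
          (summable_geometric_of_lt_one (by norm_num) (by norm_num)),
          tsum_geometric_of_lt_one (by norm_num) (by norm_num), mul_comm]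
        norm_num

lemma err_sum (δ : ℝ) (hδ : 0 < δ) : ∃ A : ℝ, 0 ≤ A ∧
    ∑' k : ℤ, (if (2:ℝ) ^ k < 1 then ENNReal.ofReal (((2:ℝ) ^ k) ^ δ) else 0) ≤ ENNReal.ofReal A := by
  set r : ℝ := (1 / 2) ^ δ with hr
  have hr0 : 0 ≤ r := by positivity
  have hr1 : r < 1 := Real.rpow_lt_one (by norm_num) (by norm_num) hδ
  refine ⟨(1 - r)⁻¹, inv_nonneg.2 (by linarith), ?_⟩
  set φ : ℤ → ℝ≥0∞ := fun k => if (2:ℝ) ^ k < 1 then ENNReal.ofReal (((2:ℝ) ^ k) ^ δ) else 0 with hφ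
  have hinj : Function.Injective fun j : ℕ => -(j : ℤ) := fun i j h => by
    simp at h; exact h
  have hsup : Function.support φ ⊆ range fun j : ℕ => -(j : ℤ) := by
    intro k hk
    have hkg : (2:ℝ) ^ k < 2 ^ (0:ℤ) := by
      by_contra hh
      rw [zpow_zero] at hh
      exact hk (by simp only [hφ]; rw [if_neg hh])
    have : k < 0 := (zpow_lt_zpow_iff_right₀ (by norm_num : (1:ℝ) < 2)).1 hkg
    exact ⟨(-k).toNat, by simp only; omega⟩
  rw [← hinj.tsum_eq hsup]
  calc ∑' j : ℕ, φ (-(j : ℤ)) ≤ ∑' j : ℕ, ENNReal.ofReal (r ^ j) := by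
        refine ENNReal.tsum_le_tsum fun j => ?_
        have : φ (-(j : ℤ)) ≤ ENNReal.ofReal (((2:ℝ) ^ (-(j:ℤ))) ^ δ) := by
          simp only [hφ]; split_ifs
          · exact le_rfl
          · exact zero_le
        refine this.trans (ENNReal.ofReal_le_ofReal (le_of_eq ?_))
        rw [hr, zpow_neg, zpow_natCast, ← inv_pow, ← Real.rpow_natCast, ← Real.rpow_natCast,
          ← Real.rpow_mul (by norm_num), ← Real.rpow_mul (by norm_num), mul_comm]
        norm_num
    _ = _ := by
        rw [← ENNReal.ofReal_tsum_of_nonneg (fun l => by positivity)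
          (summable_geometric_of_lt_one hr0 hr1), tsum_geometric_of_lt_one hr0 hr1]

lemma mem_OmA {n : ℕ} (t : ℝ) (f : (Fin n → ℝ) → ℝ) (L y : ℝ) (hL : 0 < L) (x : Fin n → ℝ)
    (hy : 0 ≤ y) (h : ENNReal.ofReal y < medianMax t f x / ENNReal.ofReal L) :
    x ∈ OmA t {z | y < |f z| / L} := by
  have h' : ENNReal.ofReal (y * L) < medianMax t f x := by
    rw [ENNReal.lt_div_iff_mul_lt (by left; simpa using hL) (by left; simp)] at h
    rwa [ENNReal.ofReal_mul hy]
  obtain ⟨Q, hQ⟩ := lt_iSup_iff.1 h'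
  obtain ⟨hx, hQ⟩ := lt_iSup_iff.1 hQ
  refine ⟨Q, hx, ?_⟩
  by_contra hcon
  have h2 := (not_le.1 hcon).le
  refine absurd hQ (not_lt.2 (sInf_le ?_))
  refine le_trans (measure_mono ?_) h2
  rintro z ⟨hz1, hz2⟩
  refine ⟨?_, hz1⟩
  have := (ENNReal.ofReal_lt_ofReal_iff_of_nonneg (by positivity)).1 hz2
  show y < |f z| / L
  rwa [lt_div_iff₀ hL]

lemma modular {n : ℕ} {p : (Fin n → ℝ) → ℝ} (hpm : Measurable p) (hp1 : ∀ x, 1 ≤ p x) {P : ℝ}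
    (hP : ∀ x, p x ≤ P) {t K c0 δ : ℝ} (hK : 0 < K) (hδ : 0 < δ)
    (hcore : ∀ α : ℝ, 0 < α →
      ∀ G : Set (Fin n → ℝ), MeasurableSet G → nu p α G ≤ ENNReal.ofReal c0 →
      nu p α (OmA t G) ≤ ENNReal.ofReal K *
        (nu p α G + (if α < 1 then ENNReal.ofReal (α ^ δ) else 0))) :
    ∃ C3 : ℝ, 1 ≤ C3 ∧ ∀ f : (Fin n → ℝ) → ℝ, Measurable f → ∀ L : ℝ, 0 < L →
      (∫⁻ x, ENNReal.ofReal ((|f x| / L) ^ p x)) ≤ ENNReal.ofReal c0 →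
      (∫⁻ x, ENNReal.ofReal ((|f x| / L) ^ p x)) ≤ 1 →
      (∫⁻ x, (medianMax t f x / ENNReal.ofReal L) ^ p x) ≤ ENNReal.ofReal C3 := by
  obtain ⟨A, hA0, hA⟩ := err_sum δ hδ
  have hP0 : 0 ≤ P := by linarith [hp1 0, hP 0]
  refine ⟨max 1 (2 ^ P * (K * (2 + A))), le_max_left _ _, fun f hf L hL hc hc1 => ?_⟩
  set G : ℤ → Set (Fin n → ℝ) := fun k => {z | (2:ℝ) ^ k < |f z| / L} with hG
  have hfm : Measurable fun z => |f z| / L := by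
    have : Measurable fun z => |f z| := hf.abs
    exact this.div_const L
  have hGm : ∀ k, MeasurableSet (G k) := fun k => measurableSet_lt measurable_const hfm
  have h2k : ∀ k : ℤ, (0:ℝ) < 2 ^ k := fun k => by positivity
  have hnuG : ∀ k, nu p (2 ^ k) (G k) = ∫⁻ x, (if (2:ℝ) ^ k < |f x| / L then
      ENNReal.ofReal (((2:ℝ) ^ k) ^ p x) else 0) := by
    intro k
    rw [nu_apply p _ (hGm k), ← lintegral_indicator (hGm k)]
    refine lintegral_congr fun x => ?_
    simp only [indicator_apply, hG]
    rfl
  have hifm : ∀ k : ℤ, Measurable fun x => (if (2:ℝ) ^ k < |f x| / L then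
      ENNReal.ofReal (((2:ℝ) ^ k) ^ p x) else 0) := fun k =>
    Measurable.ite (hGm k) (nu_dens_meas hpm _) measurable_const
  have hsumG : ∑' k, nu p (2 ^ k) (G k) ≤ 2 := by
    calc ∑' k, nu p (2 ^ k) (G k) = ∫⁻ x, ∑' k : ℤ, (if (2:ℝ) ^ k < |f x| / L then
          ENNReal.ofReal (((2:ℝ) ^ k) ^ p x) else 0) := by
          rw [lintegral_tsum fun k => (hifm k).aemeasurable]
          exact tsum_congr hnuG
      _ ≤ ∫⁻ x, 2 * ENNReal.ofReal ((|f x| / L) ^ p x) :=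
          lintegral_mono fun x => dyadic_sum _ _ (by positivity) (hp1 x)
      _ = 2 * ∫⁻ x, ENNReal.ofReal ((|f x| / L) ^ p x) := lintegral_const_mul' _ _ (by simp)
      _ ≤ 2 * 1 := by gcongr
      _ = 2 := mul_one _
  have hGc : ∀ k, nu p (2 ^ k) (G k) ≤ ENNReal.ofReal c0 := by
    intro k
    refine le_trans ?_ hc
    rw [hnuG k]
    refine lintegral_mono fun x => ?_
    split_ifs with h
    · exact ENNReal.ofReal_le_ofReal (Real.rpow_le_rpow (h2k k).le h.le (by linarith [hp1 x]))
    · exact zero_le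
  set T : ℤ → Set (Fin n → ℝ) := fun k => toMeasurable (nu p (2 ^ k)) (OmA t (G k)) with hT
  have hTm : ∀ k, MeasurableSet (T k) := fun k => measurableSet_toMeasurable _ _
  have hmem : ∀ k x, ENNReal.ofReal (2 ^ k) < medianMax t f x / ENNReal.ofReal L → x ∈ T k :=
    fun k x h => subset_toMeasurable _ _ (mem_OmA t f L _ hL x (h2k k).le h)
  have hpt : ∀ x, (medianMax t f x / ENNReal.ofReal L) ^ p x ≤
      ENNReal.ofReal (2 ^ P) * ∑' k : ℤ, (T k).indicator (fun x => ENNReal.ofReal (((2:ℝ) ^ k) ^ p x)) x := by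
    intro x
    have hp0 : 0 < p x := by linarith [hp1 x]
    set b := medianMax t f x / ENNReal.ofReal L with hb
    rcases eq_or_ne b 0 with h0 | h0
    · rw [h0, ENNReal.zero_rpow_of_pos hp0]; exact zero_le
    rcases eq_or_ne b ∞ with htop | htop
    · have : ∑' k : ℤ, (T k).indicator (fun x => ENNReal.ofReal (((2:ℝ) ^ k) ^ p x)) x = ∞ := by
        rw [eq_top_iff]
        calc ∞ = ∑' _j : ℕ, (1 : ℝ≥0∞) := (ENNReal.tsum_const_eq_top_of_ne_zero one_ne_zero).symm
          _ ≤ ∑' j : ℕ, (T (j:ℤ)).indicator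
              (fun x => ENNReal.ofReal (((2:ℝ) ^ (j:ℤ)) ^ p x)) x := by
              refine ENNReal.tsum_le_tsum fun j => ?_
              have hx : x ∈ T (j:ℤ) := hmem _ x (by rw [← hb, htop]; simp)
              rw [indicator_of_mem hx, ← ENNReal.ofReal_one]
              refine ENNReal.ofReal_le_ofReal (Real.one_le_rpow ?_ hp0.le)
              rw [zpow_natCast]; exact one_le_pow₀ (by norm_num)
          _ ≤ _ := ENNReal.tsum_comp_le_tsum_of_injective (f := fun j : ℕ => (j : ℤ)) Nat.cast_injective
              (fun k : ℤ => (T k).indicator (fun x => ENNReal.ofReal (((2:ℝ) ^ k) ^ p x)) x)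
      rw [this, ENNReal.mul_top (by simp; positivity)]
      exact le_top
    · have hbpos := ENNReal.toReal_pos h0 htop
      obtain ⟨k, hk0, hk1⟩ := exists_mem_Ioc_zpow hbpos (by norm_num : (1:ℝ) < 2)
      have hbe : b = ENNReal.ofReal b.toReal := (ENNReal.ofReal_toReal htop).symm
      have hx : x ∈ T k := hmem k x (by
        rw [← hb, hbe]; exact (ENNReal.ofReal_lt_ofReal_iff hbpos).2 hk0)
      calc b ^ p x = ENNReal.ofReal (b.toReal ^ p x) := by
            rw [← ENNReal.ofReal_rpow_of_nonneg hbpos.le hp0.le, ← hbe]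
        _ ≤ ENNReal.ofReal (2 ^ P * ((2:ℝ) ^ k) ^ p x) := by
            apply ENNReal.ofReal_le_ofReal
            calc b.toReal ^ p x ≤ ((2:ℝ) ^ (k + 1)) ^ p x := by gcongr
              _ = 2 ^ p x * ((2:ℝ) ^ k) ^ p x := by
                rw [zpow_add_one₀ (by norm_num), mul_comm, Real.mul_rpow (by norm_num) (h2k k).le]
              _ ≤ _ := by
                gcongr
                · norm_num
                · exact hP x
        _ = ENNReal.ofReal (2 ^ P) *
            (T k).indicator (fun x => ENNReal.ofReal (((2:ℝ) ^ k) ^ p x)) x := by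
            rw [ENNReal.ofReal_mul (by positivity), indicator_of_mem hx]
        _ ≤ _ := by
            gcongr
            exact ENNReal.le_tsum (f := fun k : ℤ =>
              (T k).indicator (fun x => ENNReal.ofReal (((2:ℝ) ^ k) ^ p x)) x) k
  calc ∫⁻ x, (medianMax t f x / ENNReal.ofReal L) ^ p x
      ≤ ∫⁻ x, ENNReal.ofReal (2 ^ P) *
        ∑' k : ℤ, (T k).indicator (fun x => ENNReal.ofReal (((2:ℝ) ^ k) ^ p x)) x := lintegral_mono hpt
    _ = ENNReal.ofReal (2 ^ P) * ∑' k : ℤ, nu p (2 ^ k) (T k) := by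
        rw [lintegral_const_mul' _ _ (by simp), lintegral_tsum fun k =>
          ((nu_dens_meas hpm _).indicator (hTm k)).aemeasurable]
        congr 1
        refine tsum_congr fun k => ?_
        rw [lintegral_indicator (hTm k), nu_apply p _ (hTm k)]
    _ = ENNReal.ofReal (2 ^ P) * ∑' k : ℤ, nu p (2 ^ k) (OmA t (G k)) := by
        simp only [hT, measure_toMeasurable]
    _ ≤ ENNReal.ofReal (2 ^ P) * ∑' k : ℤ, ENNReal.ofReal K * (nu p (2 ^ k) (G k) +
          (if (2:ℝ) ^ k < 1 then ENNReal.ofReal (((2:ℝ) ^ k) ^ δ) else 0)) := by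
        gcongr with k
        exact hcore _ (h2k k) _ (hGm k) (hGc k)
    _ ≤ ENNReal.ofReal (2 ^ P) * (ENNReal.ofReal K * (2 + ENNReal.ofReal A)) := by
        rw [ENNReal.tsum_mul_left, ENNReal.tsum_add]
        gcongr
    _ = ENNReal.ofReal (2 ^ P * (K * (2 + A))) := by
        rw [ENNReal.ofReal_mul (by positivity), ENNReal.ofReal_mul hK.le,
          ENNReal.ofReal_add (by norm_num) hA0]
        simp
    _ ≤ _ := ENNReal.ofReal_le_ofReal (le_max_right _ _)

lemma fwd {n : ℕ} {p : (Fin n → ℝ) → ℝ} (hpm : Measurable p) (hp1 : ∀ x, 1 ≤ p x) {P : ℝ}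
    (hP : ∀ x, p x ≤ P) (h : AInfty p) : ∃ t ∈ Ioo (0 : ℝ) 1, ∃ C : ℝ, 0 < C ∧
      ∀ f : (Fin n → ℝ) → ℝ, Measurable f → vnorm p (ofR f) < ∞ →
        vnorm p (medianMax t f) ≤ ENNReal.ofReal C * vnorm p (ofR f) := by
  obtain ⟨lam, hlam, C, hC, hA⟩ := h
  have hall := PP_all hpm hp1 hP hlam.1 hlam.2 (PP_of_AInfty hpm hp1 hP hC hA)
  obtain ⟨K, c0, δ, hK, hc0, hδ, hcore⟩ := core hpm hp1 hP hall (1 / 2) (by norm_num) (by norm_num)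
  obtain ⟨C3, hC3, hmod⟩ := modular hpm hp1 hP hK hδ hcore
  set c : ℝ := min c0 1 with hc
  have hcpos : 0 < c := lt_min hc0 one_pos
  have hc1 : c ≤ 1 := min_le_right _ _
  refine ⟨1 / 2, by constructor <;> norm_num, C3 / c, by positivity, fun f hf _ => ?_⟩
  have hCne : ENNReal.ofReal (C3 / c) ≠ 0 := by
    have : 0 < C3 / c := by positivity
    simpa using this
  rw [mul_comm, ← ENNReal.div_le_iff_le_mul (by left; exact hCne) (by left; simp)]
  refine le_sInf ?_
  rintro l ⟨hl0, hl⟩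
  rw [ENNReal.div_le_iff_le_mul (by left; exact hCne) (by left; simp)]
  rcases eq_or_ne l ∞ with htop | htop
  · rw [htop, ENNReal.top_mul hCne]; exact le_top
  have hlr := ENNReal.toReal_pos hl0.ne' htop
  have hle : l = ENNReal.ofReal l.toReal := (ENNReal.ofReal_toReal htop).symm
  set r := l.toReal with hr
  rw [hle] at hl ⊢
  set L : ℝ := r / c with hL
  have hLpos : 0 < L := by positivity
  have hfint : ∫⁻ x, ENNReal.ofReal ((|f x| / L) ^ p x) ≤ ENNReal.ofReal c := by
    calc ∫⁻ x, ENNReal.ofReal ((|f x| / L) ^ p x)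
        ≤ ∫⁻ x, ENNReal.ofReal c * (ofR f x / ENNReal.ofReal r) ^ p x := by
          refine lintegral_mono fun x => ?_
          rw [ofR, ← ENNReal.ofReal_div_of_pos hlr, ENNReal.ofReal_rpow_of_nonneg (by positivity)
            (by linarith [hp1 x]), ← ENNReal.ofReal_mul hcpos.le]
          apply ENNReal.ofReal_le_ofReal
          have e : |f x| / L = c * (|f x| / r) := by rw [hL]; field_simp
          rw [e, Real.mul_rpow hcpos.le (by positivity)]
          gcongr
          calc c ^ p x ≤ c ^ (1:ℝ) := Real.rpow_le_rpow_of_exponent_ge hcpos hc1 (hp1 x)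
            _ = c := Real.rpow_one c
      _ = ENNReal.ofReal c * ∫⁻ x, (ofR f x / ENNReal.ofReal r) ^ p x :=
          lintegral_const_mul' _ _ (by simp)
      _ ≤ ENNReal.ofReal c * 1 := by gcongr
      _ = _ := mul_one _
  have hb := hmod f hf L hLpos (hfint.trans (ENNReal.ofReal_le_ofReal (min_le_left _ _)))
    (hfint.trans (by simpa using hc1))
  have hC30 : 0 < C3 := by linarith
  rw [← ENNReal.ofReal_mul hlr.le]
  refine sInf_le ⟨by simp; positivity, ?_⟩
  have e : r * (C3 / c) = L * C3 := by rw [hL]; ring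
  rw [e]
  calc ∫⁻ x, (medianMax (1 / 2) f x / ENNReal.ofReal (L * C3)) ^ p x
      ≤ ∫⁻ x, ENNReal.ofReal C3⁻¹ * (medianMax (1 / 2) f x / ENNReal.ofReal L) ^ p x := by
        refine lintegral_mono fun x => ?_
        have hp0 : 0 ≤ p x := by linarith [hp1 x]
        have e2 : medianMax (1 / 2) f x / ENNReal.ofReal (L * C3) =
            ENNReal.ofReal C3⁻¹ * (medianMax (1 / 2) f x / ENNReal.ofReal L) := by
          generalize medianMax (1 / 2) f x = M
          rw [ENNReal.ofReal_mul hLpos.le, div_eq_mul_inv, div_eq_mul_inv,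
            ENNReal.mul_inv (by left; simpa using hLpos) (by left; simp),
            ENNReal.ofReal_inv_of_pos hC30]
          ring
        rw [e2, ENNReal.mul_rpow_of_nonneg _ _ hp0]
        gcongr
        rw [ENNReal.ofReal_rpow_of_nonneg (by positivity) hp0]
        apply ENNReal.ofReal_le_ofReal
        calc C3⁻¹ ^ p x ≤ C3⁻¹ ^ (1:ℝ) := Real.rpow_le_rpow_of_exponent_ge (by positivity)
              (inv_le_one_of_one_le₀ hC3) (hp1 x)
          _ = C3⁻¹ := Real.rpow_one _
    _ = ENNReal.ofReal C3⁻¹ * ∫⁻ x, (medianMax (1 / 2) f x / ENNReal.ofReal L) ^ p x :=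
        lintegral_const_mul' _ _ (by simp)
    _ ≤ ENNReal.ofReal C3⁻¹ * ENNReal.ofReal C3 := by gcongr
    _ = 1 := by
        rw [← ENNReal.ofReal_mul (by positivity), inv_mul_cancel₀ hC30.ne']; simp

lemma vnorm_mono {n : ℕ} {p : (Fin n → ℝ) → ℝ} (hp1 : ∀ x, 1 ≤ p x)
    {f g : (Fin n → ℝ) → ℝ≥0∞} (h : ∀ x, f x ≤ g x) : vnorm p f ≤ vnorm p g := by
  refine sInf_le_sInf fun lam hl => ⟨hl.1, le_trans (lintegral_mono fun x => ?_) hl.2⟩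
  exact ENNReal.rpow_le_rpow (ENNReal.div_le_div_right (h x) _) (by linarith [hp1 x])

lemma vnorm_congr {n : ℕ} {p q : (Fin n → ℝ) → ℝ} (h : p =ᵐ[volume] q)
    (f : (Fin n → ℝ) → ℝ≥0∞) : vnorm p f = vnorm q f := by
  have e : ∀ lam : ℝ≥0∞, (∫⁻ x, (f x / lam) ^ p x) = ∫⁻ x, (f x / lam) ^ q x := fun lam =>
    lintegral_congr_ae (by filter_upwards [h] with x hx; rw [hx])
  simp only [vnorm, e]

lemma cubeSum_meas {n : ℕ} {F : Set (RCube n)} (hF : F.Countable) (s : RCube n → ℝ)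
    (E : RCube n → Set (Fin n → ℝ)) (hE : ∀ Q ∈ F, MeasurableSet (E Q)) :
    Measurable (cubeSum F s E) := by
  have e : cubeSum F s E = fun x => ⨆ Q ∈ F, (E Q).indicator
      (fun _ => ENNReal.ofReal (s Q)) x := by
    funext x
    unfold cubeSum
    refine iSup_congr fun Q => iSup_congr fun _ => ?_
    by_cases hx : x ∈ E Q <;> simp [hx]
  rw [e]
  exact Measurable.biSup F hF fun Q hQ => measurable_const.indicator (hE Q hQ)

lemma cubeSum_eq {n : ℕ} {F : Set (RCube n)} (hF : PairwiseDisjointCubes F) (s : RCube n → ℝ)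
    (E : RCube n → Set (Fin n → ℝ)) (hE : ∀ Q ∈ F, E Q ⊆ Q.toSet) {Q : RCube n} (hQ : Q ∈ F)
    {x : Fin n → ℝ} (hx : x ∈ E Q) : cubeSum F s E x = ENNReal.ofReal (s Q) := by
  apply le_antisymm
  · refine iSup_le fun Q' => iSup_le fun hQ' => iSup_le fun hx' => ?_
    by_cases h : Q' = Q
    · rw [h]
    · exact absurd (hE Q hQ hx) (Set.disjoint_left.1 (hF hQ' hQ h) (hE Q' hQ' hx'))
  · exact le_iSup_of_le Q (le_iSup_of_le hQ (le_iSup_of_le hx le_rfl))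

lemma cubeSum_ne_top {n : ℕ} {F : Set (RCube n)} (hF : PairwiseDisjointCubes F) (s : RCube n → ℝ)
    (E : RCube n → Set (Fin n → ℝ)) (hE : ∀ Q ∈ F, E Q ⊆ Q.toSet)
    (x : Fin n → ℝ) : cubeSum F s E x ≠ ∞ := by
  by_cases h : ∃ Q ∈ F, x ∈ E Q
  · obtain ⟨Q, hQ, hx⟩ := h
    rw [cubeSum_eq hF s E hE hQ hx]
    exact ENNReal.ofReal_ne_top
  · push Not at h
    have : cubeSum F s E x ≤ 0 :=
      iSup_le fun Q' => iSup_le fun hQ' => iSup_le fun hx' => absurd hx' (h Q' hQ')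
    exact ne_top_of_le_ne_top (by simp) this

lemma bwd {n : ℕ} {p : (Fin n → ℝ) → ℝ} (hp1 : ∀ x, 1 ≤ p x) {t : ℝ} (ht : t ∈ Ioo (0:ℝ) 1)
    {C : ℝ} (hC : 0 < C)
    (h : ∀ f : (Fin n → ℝ) → ℝ, Measurable f → vnorm p (ofR f) < ∞ →
        vnorm p (medianMax t f) ≤ ENNReal.ofReal C * vnorm p (ofR f)) : AInfty p := by
  refine ⟨(1 + t) / 2, ⟨by linarith [ht.1], by linarith [ht.2]⟩, C, hC, ?_⟩
  intro F hF s hs E hE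
  have hE2 : ∀ Q ∈ F, E Q ⊆ Q.toSet := fun Q hQ => (hE Q hQ).2.1
  have hm := cubeSum_meas hF.countable s E (fun Q hQ => (hE Q hQ).1)
  have hofR : ofR (fun x => (cubeSum F s E x).toReal) = cubeSum F s E := by
    funext x
    simp only [ofR]
    rw [abs_of_nonneg ENNReal.toReal_nonneg, ENNReal.ofReal_toReal (cubeSum_ne_top hF s E hE2 x)]
  have hb := h (fun x => (cubeSum F s E x).toReal) hm.ennreal_toReal
  rw [hofR] at hb
  by_cases hfin : vnorm p (cubeSum F s E) < ∞
  · refine le_trans (vnorm_mono hp1 fun x => ?_) (hb hfin)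
    refine iSup_le fun Q => iSup_le fun hQ => iSup_le fun hx => ?_
    refine le_iSup_of_le Q (le_iSup_of_le hx ?_)
    refine le_sInf fun a ha => ?_
    by_contra hlt
    push Not at hlt
    have hsub : E Q ⊆ {x | x ∈ Q.toSet ∧
        a < ENNReal.ofReal |(fun x => (cubeSum F s E x).toReal) x|} := by
      intro y hy
      refine ⟨hE2 Q hQ hy, ?_⟩
      have := congrFun hofR y
      simp only [ofR] at this
      simp only [this]
      rwa [cubeSum_eq hF s E hE2 hQ hy]
    have h1 := ((hE Q hQ).2.2.trans (measure_mono hsub)).trans ha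
    have h2 : ENNReal.ofReal ((1 + t) / 2) ≤ ENNReal.ofReal t :=
      (ENNReal.mul_le_mul_iff_left Q.vol_ne_zero Q.vol_ne_top).1 h1
    rw [ENNReal.ofReal_le_ofReal_iff ht.1.le] at h2
    linarith [ht.2]
  · have : vnorm p (cubeSum F s E) = ∞ := by simpa using hfin
    rw [this, ENNReal.mul_top (by simpa using hC)]
    exact le_top

theorem statement2 {n : ℕ} (p : (Fin n → ℝ) → ℝ) (hpm : Measurable p)
    (hp1 : ∀ x, 1 ≤ p x)
    (hup : ∃ B : ℝ, ∀ᵐ x ∂(volume : Measure (Fin n → ℝ)), p x ≤ B) :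
    AInfty p ↔ ∃ t ∈ Ioo (0 : ℝ) 1, ∃ C : ℝ, 0 < C ∧
      ∀ f : (Fin n → ℝ) → ℝ, Measurable f → vnorm p (ofR f) < ∞ →
        vnorm p (medianMax t f) ≤ ENNReal.ofReal C * vnorm p (ofR f) := by
  constructor
  · intro hA
    obtain ⟨B, hB⟩ := hup
    have hae : p =ᵐ[volume] fun x => min (p x) (max B 1) := by
      filter_upwards [hB] with x hx
      exact (min_eq_left (hx.trans (le_max_left _ _))).symm
    have hv := fun f => vnorm_congr hae f
    have hA' : AInfty fun x => min (p x) (max B 1) := by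
      simpa only [AInfty, AInftyWith, hv] using hA
    have := fwd (P := max B 1) (hpm.min measurable_const)
      (fun x => le_min (hp1 x) (le_max_right _ _)) (fun x => min_le_right _ _) hA'
    simpa only [hv] using this
  · rintro ⟨t, ht, C, hC, h⟩
    exact bwd hp1 ht hC h
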